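/- arXiv:2203.06766 — 8 statements merged into one kernel-verified Lean document; each statement's English description precedes it below -/
import Mathlib

section
/- Let m ≥ 1 be an integer and let C be the cycle graph on vertex set ℤ/6mℤ in which i and i+1 are adjacent for every i. Let S be a cluster deletion set of C with exactly 2m vertices. Then: (i) for every j with 0 ≤ j < 2m, S contains exactly one vertex of the triple {3j, 3j+1, 3j+2}; (ii) S contains either all or none of the vertices {6j : 0 ≤ j < m}, and S contains either all or none of the vertices {6j+1 : 0 ≤ j < m}; (iii) for every j with 0 ≤ j < m, S does not contain both 6j and 6j+1, and each of the vertices 6j and 6j+1 has a neighbor not in S. -/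
/-- `G` has an induced subgraph isomorphic to the `d`-claw `K_{1,d}`:
a center `v` together with `d` pairwise nonadjacent leaves adjacent to `v`. -/
def HasNClaw {V : Type*} (G : SimpleGraph V) (d : ℕ) : Prop :=
  ∃ (v : V) (s : Finset V), s.card = d ∧ v ∉ s ∧ (∀ u ∈ s, G.Adj v u) ∧
    ∀ u ∈ s, ∀ w ∈ s, u ≠ w → ¬ G.Adj u w

/-- `S` is a `d`-claw deletion set of `G`: `G − S` has no induced `K_{1,d}`. -/
def IsClawDeletionSet {V : Type*} (G : SimpleGraph V) (d : ℕ) (S : Set V) : Prop :=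
  ¬ HasNClaw (G.induce Sᶜ) d

/-- `S` is a vertex cover of `G`. -/
def IsVertexCoverSet {V : Type*} (G : SimpleGraph V) (S : Set V) : Prop :=
  ∀ ⦃u v⦄, G.Adj u v → u ∈ S ∨ v ∈ S

/-- The cycle graph on `ZMod n`: `i` and `j` are adjacent iff they are distinct and
differ by `1`. -/
def cycGraph (n : ℕ) : SimpleGraph (ZMod n) :=
  SimpleGraph.fromRel (fun i j => j = i + 1)

theorem natCast_zmod_ne_zero {n k : ℕ} (hk : 0 < k) (hkn : k < n) : (k : ZMod n) ≠ 0 := by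
  rw [Ne, ZMod.natCast_eq_zero_iff]
  exact Nat.not_dvd_of_pos_of_lt hk hkn

theorem cycGraph_adj_add_one {n : ℕ} (hn : 1 < n) (x : ZMod n) :
    (cycGraph n).Adj x (x + 1) := by
  have h := natCast_zmod_ne_zero (n := n) one_pos hn
  rw [cycGraph, SimpleGraph.fromRel_adj]
  exact ⟨by simpa using h, Or.inl rfl⟩

theorem cycGraph_not_adj_add_two {n : ℕ} (hn : 3 < n) (x : ZMod n) :
    ¬ (cycGraph n).Adj x (x + 2) := by
  have h1 := natCast_zmod_ne_zero (n := n) (k := 1) (by omega) (by omega)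
  have h3 := natCast_zmod_ne_zero (n := n) (k := 3) (by omega) hn
  push_cast at h1 h3
  rw [cycGraph, SimpleGraph.fromRel_adj]
  rintro ⟨-, h | h⟩
  · exact h1 (by linear_combination h)
  · exact h3 (by linear_combination -h)

/-- A cluster deletion set of a cycle meets every three consecutive vertices. -/
theorem IsClawDeletionSet.mem_of_consecutive {n : ℕ} (hn : 3 < n) {S : Set (ZMod n)}
    (hdel : IsClawDeletionSet (cycGraph n) 2 S) (x : ZMod n) :
    x ∈ S ∨ x + 1 ∈ S ∨ x + 2 ∈ S := by
  by_contra! h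
  obtain ⟨h0, h1, h2⟩ := h
  have h2n := natCast_zmod_ne_zero (n := n) (k := 2) (by omega) (by omega)
  push_cast at h2n
  have a01 := cycGraph_adj_add_one (n := n) (by omega) x
  have a12 := cycGraph_adj_add_one (n := n) (by omega) (x + 1)
  rw [show x + 1 + 1 = x + 2 by ring] at a12
  have a02 := cycGraph_not_adj_add_two hn x
  classical
  refine hdel ⟨⟨x + 1, h1⟩, {⟨x, h0⟩, ⟨x + 2, h2⟩}, ?_, ?_, ?_, ?_⟩
  · rw [Finset.card_pair]
    simpa using h2n
  · simp only [Finset.mem_insert, Finset.mem_singleton, Subtype.mk.injEq, not_or]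
    exact ⟨a01.ne', a12.ne⟩
  · simpa using ⟨a01.symm, a12⟩
  · simp [a02, mt SimpleGraph.Adj.symm a02]

open scoped Classical in
/-- A cluster deletion set of size `n / 3` of the `n`-cycle meets every three consecutive
vertices exactly once. -/
theorem IsClawDeletionSet.indicator_consecutive {n : ℕ} (hn : 3 < n) {S : Set (ZMod n)}
    (hdel : IsClawDeletionSet (cycGraph n) 2 S) (hcard : 3 * S.ncard = n) (x : ZMod n) :
    (if x ∈ S then 1 else 0) + (if x + 1 ∈ S then 1 else 0) + (if x + 2 ∈ S then 1 else 0)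
      = 1 := by
  have : NeZero n := ⟨by omega⟩
  let f : ZMod n → ℕ := fun y => if y ∈ S then 1 else 0
  have hf : ∑ y, f y = S.ncard := by
    rw [Set.ncard_eq_toFinset_card', Finset.sum_boole]
    simp [Set.toFinset]
  have hshift (c : ZMod n) : ∑ y, f (y + c) = ∑ y, f y :=
    Equiv.sum_comp (Equiv.addRight c) f
  have hsum : ∑ _y : ZMod n, 1 = ∑ y, (f y + f (y + 1) + f (y + 2)) := by
    rw [Finset.sum_add_distrib, Finset.sum_add_distrib, hshift, hshift, hf]
    simp [ZMod.card]
    omega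
  have hle : ∀ y ∈ Finset.univ, 1 ≤ f y + f (y + 1) + f (y + 2) := by
    intro y _
    have h := hdel.mem_of_consecutive hn y
    simp only [f]
    split_ifs <;> simp_all
  exact ((Finset.sum_eq_sum_iff_of_le hle).1 hsum x (Finset.mem_univ x)).symm

/-- Exactly one of three consecutive vertices lies in a cluster deletion set of size `n / 3`
of the `n`-cycle. -/
theorem IsClawDeletionSet.exactly_one_of_consecutive {n : ℕ} (hn : 3 < n) {S : Set (ZMod n)}
    (hdel : IsClawDeletionSet (cycGraph n) 2 S) (hcard : 3 * S.ncard = n) (x : ZMod n) :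
    (x ∈ S ∧ x + 1 ∉ S ∧ x + 2 ∉ S) ∨ (x ∉ S ∧ x + 1 ∈ S ∧ x + 2 ∉ S) ∨
      (x ∉ S ∧ x + 1 ∉ S ∧ x + 2 ∈ S) := by
  have h := hdel.indicator_consecutive hn hcard x
  split_ifs at h <;> simp_all

theorem IsClawDeletionSet.add_three_mem_iff {n : ℕ} (hn : 3 < n) {S : Set (ZMod n)}
    (hdel : IsClawDeletionSet (cycGraph n) 2 S) (hcard : 3 * S.ncard = n) (x : ZMod n) :
    x + 3 ∈ S ↔ x ∈ S := by
  have h0 := hdel.exactly_one_of_consecutive hn hcard x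
  have h1 := hdel.exactly_one_of_consecutive hn hcard (x + 1)
  rw [show x + 1 + 1 = x + 2 by ring, show x + 1 + 2 = x + 3 by ring] at h1
  tauto

theorem IsClawDeletionSet.add_six_mul_mem_iff {n : ℕ} (hn : 3 < n) {S : Set (ZMod n)}
    (hdel : IsClawDeletionSet (cycGraph n) 2 S) (hcard : 3 * S.ncard = n) (x : ZMod n)
    (j : ℕ) : 6 * (j : ZMod n) + x ∈ S ↔ x ∈ S := by
  induction j with
  | zero => simp
  | succ j ih =>
    rw [← ih, ← hdel.add_three_mem_iff hn hcard (6 * (j : ZMod n) + x),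
      ← hdel.add_three_mem_iff hn hcard (6 * (j : ZMod n) + x + 3)]
    push_cast
    ring_nf

theorem IsClawDeletionSet.exists_adj_notMem {n : ℕ} (hn : 3 < n) {S : Set (ZMod n)}
    (hdel : IsClawDeletionSet (cycGraph n) 2 S) (hcard : 3 * S.ncard = n) (x : ZMod n) :
    ∃ w, (cycGraph n).Adj x w ∧ w ∉ S := by
  have h := hdel.exactly_one_of_consecutive hn hcard (x - 1)
  rw [show x - 1 + 1 = x by ring, show x - 1 + 2 = x + 1 by ring] at h
  by_cases hx : x + 1 ∈ S
  · have hadj := cycGraph_adj_add_one (n := n) (by omega) (x - 1)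
    rw [sub_add_cancel] at hadj
    exact ⟨x - 1, hadj.symm, by tauto⟩
  · exact ⟨x + 1, cycGraph_adj_add_one (by omega) x, hx⟩

theorem IsClawDeletionSet.ncard_inter_consecutive {n : ℕ} (hn : 3 < n) {S : Set (ZMod n)}
    (hdel : IsClawDeletionSet (cycGraph n) 2 S) (hcard : 3 * S.ncard = n) (x : ZMod n) :
    (S ∩ {x, x + 1, x + 2}).ncard = 1 := by
  rw [Set.ncard_eq_one]
  rcases hdel.exactly_one_of_consecutive hn hcard x with h | h | h
  · exact ⟨x, by ext y; simp; grind⟩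
  · exact ⟨x + 1, by ext y; simp; grind⟩
  · exact ⟨x + 2, by ext y; simp; grind⟩

theorem stmt6 (m : ℕ) (hm : 1 ≤ m) (S : Set (ZMod (6 * m)))
    (hdel : IsClawDeletionSet (cycGraph (6 * m)) 2 S) (hcard : S.ncard = 2 * m) :
    (∀ j : ℕ, j < 2 * m →
      (S ∩ {((3 * j : ℕ) : ZMod (6 * m)), ((3 * j + 1 : ℕ) : ZMod (6 * m)),
            ((3 * j + 2 : ℕ) : ZMod (6 * m))}).ncard = 1) ∧
    ((∀ j : ℕ, j < m → ((6 * j : ℕ) : ZMod (6 * m)) ∈ S) ∨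
      (∀ j : ℕ, j < m → ((6 * j : ℕ) : ZMod (6 * m)) ∉ S)) ∧
    ((∀ j : ℕ, j < m → ((6 * j + 1 : ℕ) : ZMod (6 * m)) ∈ S) ∨
      (∀ j : ℕ, j < m → ((6 * j + 1 : ℕ) : ZMod (6 * m)) ∉ S)) ∧
    (∀ j : ℕ, j < m →
      ¬(((6 * j : ℕ) : ZMod (6 * m)) ∈ S ∧ ((6 * j + 1 : ℕ) : ZMod (6 * m)) ∈ S) ∧
      (∃ w, (cycGraph (6 * m)).Adj ((6 * j : ℕ) : ZMod (6 * m)) w ∧ w ∉ S) ∧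
      (∃ w, (cycGraph (6 * m)).Adj ((6 * j + 1 : ℕ) : ZMod (6 * m)) w ∧ w ∉ S)) := by
  have hn : 3 < 6 * m := by omega
  have hcard' : 3 * S.ncard = 6 * m := by omega
  have hper := hdel.add_six_mul_mem_iff hn hcard'
  push_cast
  refine ⟨fun j _ => hdel.ncard_inter_consecutive hn hcard' _, ?_, ?_, fun j _ =>
    ⟨?_, hdel.exists_adj_notMem hn hcard' _, hdel.exists_adj_notMem hn hcard' _⟩⟩
  · have h0 (j : ℕ) : 6 * (j : ZMod (6 * m)) ∈ S ↔ 0 ∈ S := by simpa using hper 0 j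
    simp only [h0]
    tauto
  · simp only [hper 1]
    tauto
  · have := hdel.exactly_one_of_consecutive hn hcard' (6 * (j : ZMod (6 * m)))
    tauto
end

section
/- Let Γ be the 30-vertex clause-gadget graph defined as follows: for each k ∈ {0,1,2} take eight new vertices forming an 8-cycle c_k – a_k – b_k – x_k – x'_k – b'_k – a'_k – c'_k – c_k, and for each k ∈ {0,1,2} add two further new vertices p_k, p'_k together with the edges x'_k p_k, p_k p'_k and p'_k x_{k+1} (index k+1 taken modulo 3); these are all vertices and edges of Γ. Then every cluster deletion set of Γ has at least 11 vertices, there exists a cluster deletion set of Γ of size exactly 11, no cluster deletion set of size 11 contains all three vertices c_0, c_1, c_2, and no cluster deletion set of size 11 contains all three vertices c'_0, c'_1, c'_2. -/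
/-- The 30-vertex clause gadget: vertex `(k, i)` with `k ∈ ZMod 3` indexing the copy and
`i ∈ Fin 10` the label, where `0 = c_k`, `1 = a_k`, `2 = b_k`, `3 = x_k`, `4 = x'_k`,
`5 = b'_k`, `6 = a'_k`, `7 = c'_k`, `8 = p_k`, `9 = p'_k`.
For each `k` there is an 8-cycle `c_k a_k b_k x_k x'_k b'_k a'_k c'_k c_k`, plus the
edges `x'_k p_k`, `p_k p'_k` and `p'_k x_{k+1}` (index modulo 3). -/
def clauseGadget : SimpleGraph (ZMod 3 × Fin 10) :=
  SimpleGraph.fromRel (fun a b =>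
    (a.1 = b.1 ∧
      ((a.2 = 0 ∧ b.2 = 1) ∨ (a.2 = 1 ∧ b.2 = 2) ∨ (a.2 = 2 ∧ b.2 = 3) ∨
        (a.2 = 3 ∧ b.2 = 4) ∨ (a.2 = 4 ∧ b.2 = 5) ∨ (a.2 = 5 ∧ b.2 = 6) ∨
        (a.2 = 6 ∧ b.2 = 7) ∨ (a.2 = 7 ∧ b.2 = 0) ∨ (a.2 = 4 ∧ b.2 = 8) ∨
        (a.2 = 8 ∧ b.2 = 9))) ∨
    (b.1 = a.1 + 1 ∧ a.2 = 9 ∧ b.2 = 3))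

theorem isClawDeletionSet_two_iff {V : Type*} (G : SimpleGraph V) (S : Set V) :
    IsClawDeletionSet G 2 S ↔
      ∀ v u w, G.Adj v u → G.Adj v w → u ≠ w → ¬ G.Adj u w → v ∈ S ∨ u ∈ S ∨ w ∈ S := by
  classical
  constructor
  · intro h v u w hvu hvw huw hn
    by_contra! hS
    obtain ⟨hv, hu, hw⟩ := hS
    refine h ⟨⟨v, hv⟩, {⟨u, hu⟩, ⟨w, hw⟩}, ?_, ?_, ?_, ?_⟩
    · exact Finset.card_pair (by simpa using huw)
    · simp [hvu.ne, hvw.ne]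
    · simp [hvu, hvw]
    · simp [hn, mt G.adj_symm hn]
  · rintro h ⟨v, s, hs, -, hadj, hind⟩
    obtain ⟨u, w, huw, rfl⟩ := Finset.card_eq_two.mp hs
    have := h v u w (hadj u (by simp)) (hadj w (by simp)) (Subtype.coe_injective.ne huw)
      (hind u (by simp) w (by simp) huw)
    exact this.elim v.2 (Or.elim · u.2 w.2)

instance : DecidableRel clauseGadget.Adj := fun a b =>
  decidable_of_iff _ (SimpleGraph.fromRel_adj _ a b).symm

/-- `T` meets every induced `P₃` inside one copy of the clause gadget. -/
def HitsBlock (T : Finset (Fin 10)) : Prop :=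
  (0 ∈ T ∨ 1 ∈ T ∨ 2 ∈ T) ∧ (1 ∈ T ∨ 2 ∈ T ∨ 3 ∈ T) ∧ (2 ∈ T ∨ 3 ∈ T ∨ 4 ∈ T) ∧
  (3 ∈ T ∨ 4 ∈ T ∨ 5 ∈ T) ∧ (4 ∈ T ∨ 5 ∈ T ∨ 6 ∈ T) ∧ (5 ∈ T ∨ 6 ∈ T ∨ 7 ∈ T) ∧
  (6 ∈ T ∨ 7 ∈ T ∨ 0 ∈ T) ∧ (7 ∈ T ∨ 0 ∈ T ∨ 1 ∈ T) ∧ (3 ∈ T ∨ 4 ∈ T ∨ 8 ∈ T) ∧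
  (5 ∈ T ∨ 4 ∈ T ∨ 8 ∈ T) ∧ (4 ∈ T ∨ 8 ∈ T ∨ 9 ∈ T)

instance : DecidablePred HitsBlock := fun T => by
  unfold HitsBlock
  infer_instance

theorem HitsBlock.card_bounds : ∀ {T : Finset (Fin 10)}, HitsBlock T →
    3 ≤ T.card ∧ (T.card = 3 → 3 ∉ T ∧ 8 ∉ T ∧ 9 ∉ T) ∧ (0 ∈ T → 4 ≤ T.card) ∧
      (7 ∈ T → 3 ∈ T → T.card = 4 → 8 ∉ T ∧ 9 ∉ T) := by
  decide +kernel

open Classical in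
/-- The labels of the vertices of `S` in copy `k` of the clause gadget. -/
noncomputable def blockPart (S : Set (ZMod 3 × Fin 10)) (k : ZMod 3) : Finset (Fin 10) :=
  Finset.univ.filter fun i => (k, i) ∈ S

@[simp]
theorem mem_blockPart {S : Set (ZMod 3 × Fin 10)} {k : ZMod 3} {i : Fin 10} :
    i ∈ blockPart S k ↔ (k, i) ∈ S := by
  simp [blockPart]

theorem ncard_eq_sum_card_blockPart (S : Set (ZMod 3 × Fin 10)) :
    S.ncard = (blockPart S 0).card + (blockPart S 1).card + (blockPart S 2).card := by
  classical
  have h : S.ncard = ((Finset.univ : Finset (ZMod 3)).sigma (blockPart S)).card := by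
    rw [← Set.ncard_coe_finset]
    refine Set.ncard_congr (fun a _ => ⟨a.1, a.2⟩) ?_ ?_ ?_
    · simp
    · rintro ⟨a, b⟩ ⟨c, d⟩ - - h
      simpa using h
    · rintro ⟨a, b⟩ h
      exact ⟨(a, b), by simpa using h, rfl⟩
  rw [h, Finset.card_sigma]
  exact Fin.sum_univ_three _

theorem hitsBlock_blockPart {S : Set (ZMod 3 × Fin 10)}
    (hS : IsClawDeletionSet clauseGadget 2 S) (k : ZMod 3) : HitsBlock (blockPart S k) := by
  rw [isClawDeletionSet_two_iff] at hS
  have hit (u v w : Fin 10)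
      (h : ∀ k : ZMod 3, clauseGadget.Adj (k, v) (k, u) ∧ clauseGadget.Adj (k, v) (k, w) ∧
        (k, u) ≠ (k, w) ∧ ¬ clauseGadget.Adj (k, u) (k, w)) :
      u ∈ blockPart S k ∨ v ∈ blockPart S k ∨ w ∈ blockPart S k := by
    obtain ⟨hu, hw, hne, hn⟩ := h k
    simp only [mem_blockPart]
    exact or_left_comm.mp (hS _ _ _ hu hw hne hn)
  refine ⟨?_, ?_, ?_, ?_, ?_, ?_, ?_, ?_, ?_, ?_, ?_⟩ <;> exact hit _ _ _ (by decide +kernel)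

theorem three_mem_blockPart_succ {S : Set (ZMod 3 × Fin 10)}
    (hS : IsClawDeletionSet clauseGadget 2 S) (k : ZMod 3)
    (h8 : 8 ∉ blockPart S k) (h9 : 9 ∉ blockPart S k) : 3 ∈ blockPart S (k + 1) := by
  rw [isClawDeletionSet_two_iff] at hS
  have hP : ∀ k : ZMod 3, clauseGadget.Adj (k, 9) (k, 8) ∧ clauseGadget.Adj (k, 9) (k + 1, 3) ∧
      ((k, 8) : ZMod 3 × Fin 10) ≠ (k + 1, 3) ∧ ¬ clauseGadget.Adj (k, 8) (k + 1, 3) := by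
    decide +kernel
  obtain ⟨hu, hw, hne, hn⟩ := hP k
  simp only [mem_blockPart] at *
  have := hS _ _ _ hu hw hne hn
  tauto

theorem eleven_le_ncard {S : Set (ZMod 3 × Fin 10)}
    (hS : IsClawDeletionSet clauseGadget 2 S) : 11 ≤ S.ncard := by
  have b0 := (hitsBlock_blockPart hS 0).card_bounds
  have b1 := (hitsBlock_blockPart hS 1).card_bounds
  have b2 := (hitsBlock_blockPart hS 2).card_bounds
  have s0 : _ → _ → 3 ∈ blockPart S 1 := three_mem_blockPart_succ hS 0
  have s1 : _ → _ → 3 ∈ blockPart S 2 := three_mem_blockPart_succ hS 1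
  have s2 : _ → _ → 3 ∈ blockPart S 0 := three_mem_blockPart_succ hS 2
  rw [ncard_eq_sum_card_blockPart]
  grind

theorem exists_isClawDeletionSet_ncard_eq_eleven :
    ∃ S, IsClawDeletionSet clauseGadget 2 S ∧ S.ncard = 11 := by
  let T : Finset (ZMod 3 × Fin 10) :=
    {(0, 2), (0, 4), (0, 7), (1, 0), (1, 3), (1, 5), (1, 9), (2, 0), (2, 3), (2, 5), (2, 9)}
  refine ⟨T, ?_, ?_⟩
  · rw [isClawDeletionSet_two_iff]
    simp only [Finset.mem_coe]
    decide +kernel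
  · rw [Set.ncard_coe_finset]
    decide +kernel

theorem stmt7 :
    (∀ S : Set (ZMod 3 × Fin 10), IsClawDeletionSet clauseGadget 2 S → 11 ≤ S.ncard) ∧
    (∃ S : Set (ZMod 3 × Fin 10), IsClawDeletionSet clauseGadget 2 S ∧ S.ncard = 11) ∧
    (∀ S : Set (ZMod 3 × Fin 10), IsClawDeletionSet clauseGadget 2 S → S.ncard = 11 →
      ¬ ∀ k : ZMod 3, (k, (0 : Fin 10)) ∈ S) ∧
    (∀ S : Set (ZMod 3 × Fin 10), IsClawDeletionSet clauseGadget 2 S → S.ncard = 11 →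
      ¬ ∀ k : ZMod 3, (k, (7 : Fin 10)) ∈ S) := by
  refine ⟨fun S hS => eleven_le_ncard hS, exists_isClawDeletionSet_ncard_eq_eleven, ?_, ?_⟩
  · intro S hS hcard hc
    have bound (k : ZMod 3) : 4 ≤ (blockPart S k).card :=
      (hitsBlock_blockPart hS k).card_bounds.2.2.1 (mem_blockPart.mpr (hc k))
    rw [ncard_eq_sum_card_blockPart] at hcard
    linarith [bound 0, bound 1, bound 2]
  · intro S hS hcard hc
    have b (k : ZMod 3) := (hitsBlock_blockPart hS k).card_bounds
    have c (k : ZMod 3) : 7 ∈ blockPart S k := mem_blockPart.mpr (hc k)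
    have s0 : _ → _ → 3 ∈ blockPart S 1 := three_mem_blockPart_succ hS 0
    have s1 : _ → _ → 3 ∈ blockPart S 2 := three_mem_blockPart_succ hS 1
    have s2 : _ → _ → 3 ∈ blockPart S 0 := three_mem_blockPart_succ hS 2
    have b0 := b 0
    have b1 := b 1
    have b2 := b 2
    have c0 := c 0
    have c1 := c 1
    have c2 := c 2
    rw [ncard_eq_sum_card_blockPart] at hcard
    clear b c hc hS
    grind
end

section
/- Let m ≥ 1 be an integer and let Γ be the graph consisting of m pairwise disjoint copies H^(1), …, H^(m) of the 8-vertex graph H (where H has vertices v, v', a1, a2, a3, b1, b2, b3 and edges v a1, a1 a2, a2 a3, a3 b3, b3 b2, b2 b1, b1 a1, a2 b2, b1 v', v' b3), together with the m additional edges joining the vertex a3 of H^(j) to the vertex v of H^(j+1) for each j (indices modulo m). Then every claw deletion set of Γ has at least 2m vertices, the union over j of the pairs {v^(j), b2^(j)} is a claw deletion set of Γ of size 2m, and any claw deletion set of Γ of size 2m that contains the vertex v^(j) of some copy is equal to the union over all j of {v^(j), b2^(j)} (in particular it contains every v^(j) and contains neither any v'^(j) nor any neighbor of any v'^(j)). 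-/
/-- `m` disjoint copies of the 8-vertex graph `H` (vertex `(j, i)` is the vertex of
label `i` in the `j`-th copy, with labels `0 = v`, `1 = v'`, `2 = a1`, `3 = a2`,
`4 = a3`, `5 = b1`, `6 = b2`, `7 = b3` and edges
`v a1, a1 a2, a2 a3, a3 b3, b3 b2, b2 b1, b1 a1, a2 b2, b1 v', v' b3`),
together with the edges joining `a3` of copy `j` to `v` of copy `j + 1` (mod `m`). -/
def gadgetHm (m : ℕ) : SimpleGraph (ZMod m × Fin 8) :=
  SimpleGraph.fromRel (fun a b =>
    (a.1 = b.1 ∧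
      (a.2, b.2) ∈ ([(0, 2), (2, 3), (3, 4), (4, 7), (7, 6), (6, 5), (5, 2), (3, 6),
        (5, 1), (1, 7)] : List (Fin 8 × Fin 8))) ∨
    (b.1 = a.1 + 1 ∧ a.2 = 4 ∧ b.2 = 0))

/-- A claw deletion set meets every induced claw. -/
theorem IsClawDeletionSet.mem_of_claw {V : Type*} {G : SimpleGraph V} {S : Set V}
    (hS : IsClawDeletionSet G 3 S) {c x y z : V} (hx : G.Adj c x) (hy : G.Adj c y)
    (hz : G.Adj c z) (hxy : x ≠ y) (hxz : x ≠ z) (hyz : y ≠ z)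
    (nxy : ¬ G.Adj x y) (nxz : ¬ G.Adj x z) (nyz : ¬ G.Adj y z) :
    c ∈ S ∨ x ∈ S ∨ y ∈ S ∨ z ∈ S := by
  classical
  by_contra! h
  obtain ⟨hc, hxS, hyS, hzS⟩ := h
  refine hS ⟨⟨c, hc⟩, {⟨x, hxS⟩, ⟨y, hyS⟩, ⟨z, hzS⟩}, ?_, ?_, ?_, ?_⟩
  · exact Finset.card_eq_three.2 ⟨_, _, _, by simpa using hxy, by simpa using hxz,
      by simpa using hyz, rfl⟩
  · simp [hx.ne, hy.ne, hz.ne]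
  · simp [hx, hy, hz]
  · simp [nxy, nxz, nyz, G.adj_comm y x, G.adj_comm z x, G.adj_comm z y]

/-- Five claws of `gadgetHm m` centred in the copy `j`, each met by every claw deletion set. -/
theorem gadgetHm_claws {m : ℕ} {S : Set (ZMod m × Fin 8)}
    (hS : IsClawDeletionSet (gadgetHm m) 3 S) (j : ZMod m) :
    ((j, 2) ∈ S ∨ (j, 0) ∈ S ∨ (j, 3) ∈ S ∨ (j, 5) ∈ S) ∧
    ((j, 3) ∈ S ∨ (j, 2) ∈ S ∨ (j, 4) ∈ S ∨ (j, 6) ∈ S) ∧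
    ((j, 4) ∈ S ∨ (j, 3) ∈ S ∨ (j, 7) ∈ S ∨ (j + 1, 0) ∈ S) ∧
    ((j, 5) ∈ S ∨ (j, 6) ∈ S ∨ (j, 2) ∈ S ∨ (j, 1) ∈ S) ∧
    ((j, 7) ∈ S ∨ (j, 4) ∈ S ∨ (j, 6) ∈ S ∨ (j, 1) ∈ S) := by
  refine ⟨?_, ?_, ?_, ?_, ?_⟩ <;>
  · apply hS.mem_of_claw <;> simp [gadgetHm]

/-- After deleting the labels `0` and `6`, every vertex of `gadgetHm m` has at most two neighbours. -/
theorem gadgetHm_adj_labels {m : ℕ} (i : Fin 8) (hi : ¬ (i = 0 ∨ i = 6)) :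
    ∃ x y : Fin 8, ∀ (j : ZMod m) (w : ZMod m × Fin 8), (gadgetHm m).Adj (j, i) w →
      ¬ (w.2 = 0 ∨ w.2 = 6) → w = (j, x) ∨ w = (j, y) := by
  have key : ∃ x y : Fin 8, ∀ k : Fin 8, ¬ (k = 0 ∨ k = 6) →
      ((i, k) ∈ ([(0, 2), (2, 3), (3, 4), (4, 7), (7, 6), (6, 5), (5, 2), (3, 6),
        (5, 1), (1, 7)] : List (Fin 8 × Fin 8)) ∨
       (k, i) ∈ ([(0, 2), (2, 3), (3, 4), (4, 7), (7, 6), (6, 5), (5, 2), (3, 6),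
        (5, 1), (1, 7)] : List (Fin 8 × Fin 8))) → k = x ∨ k = y := by
    revert i
    decide
  obtain ⟨x, y, hxy⟩ := key
  refine ⟨x, y, ?_⟩
  rintro j ⟨j', k⟩ hadj hk
  rw [gadgetHm, SimpleGraph.fromRel_adj] at hadj
  rcases hadj with ⟨-, (⟨rfl, h⟩ | ⟨-, -, h⟩) | (⟨rfl, h⟩ | ⟨-, -, h⟩)⟩
  · simpa using hxy k hk (Or.inl h)
  · exact absurd (Or.inl h) hk
  · simpa using hxy k hk (Or.inr h)
  · exact absurd (Or.inl h) hi

theorem gadgetHm_isClawDeletionSet (m : ℕ) :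
    IsClawDeletionSet (gadgetHm m) 3 {p : ZMod m × Fin 8 | p.2 = 0 ∨ p.2 = 6} := by
  classical
  rintro ⟨⟨⟨j, i⟩, hi⟩, s, hcard, -, hadj, -⟩
  obtain ⟨x, y, hxy⟩ := gadgetHm_adj_labels (m := m) i hi
  have hsub : s.map (Function.Embedding.subtype _) ⊆ {(j, x), (j, y)} := by
    intro w hw
    obtain ⟨u, hu, rfl⟩ := Finset.mem_map.1 hw
    simpa using hxy j u (hadj u hu) u.2
  have := (Finset.card_le_card hsub).trans Finset.card_le_two
  rw [Finset.card_map] at this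
  omega

/-- Every claw deletion set contains, in each copy, one vertex from each of the two disjoint claws centred at the labels `2` and `7`. -/
theorem gadgetHm_exists_choice {m : ℕ} {S : Set (ZMod m × Fin 8)}
    (hS : IsClawDeletionSet (gadgetHm m) 3 S) :
    ∃ f g : ZMod m → Fin 8,
      (∀ j, (j, f j) ∈ S ∧ f j ∈ ({0, 2, 3, 5} : Finset (Fin 8))) ∧
      (∀ j, (j, g j) ∈ S ∧ g j ∈ ({1, 4, 6, 7} : Finset (Fin 8))) := by
  have hf : ∀ j, ∃ i : Fin 8, (j, i) ∈ S ∧ i ∈ ({0, 2, 3, 5} : Finset (Fin 8)) := by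
    intro j
    rcases (gadgetHm_claws hS j).1 with h | h | h | h <;> exact ⟨_, h, by decide⟩
  have hg : ∀ j, ∃ i : Fin 8, (j, i) ∈ S ∧ i ∈ ({1, 4, 6, 7} : Finset (Fin 8)) := by
    intro j
    rcases (gadgetHm_claws hS j).2.2.2.2 with h | h | h | h <;> exact ⟨_, h, by decide⟩
  choose f hf using hf
  choose g hg using hg
  exact ⟨f, g, hf, hg⟩

theorem ncard_range_graph_pair {m : ℕ} [NeZero m] {f g : ZMod m → Fin 8}
    (hfg : ∀ j, f j ≠ g j) :
    (Set.range (fun j => (j, f j)) ∪ Set.range (fun j => (j, g j))).ncard = 2 * m := by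
  have hcard : ∀ h : ZMod m → Fin 8, (Set.range (fun j => (j, h j))).ncard = m := by
    intro h
    rw [← Set.image_univ, Set.ncard_image_of_injective _ (fun a b hab => (Prod.ext_iff.1 hab).1),
      Set.ncard_univ, Nat.card_zmod]
  rw [Set.ncard_union_eq _ (Set.toFinite _) (Set.toFinite _), hcard, hcard, two_mul]
  rw [Set.disjoint_left]
  rintro _ ⟨j, rfl⟩ ⟨k, hk⟩
  obtain ⟨rfl, h⟩ := Prod.ext_iff.1 hk
  exact hfg _ h.symm

theorem stmt9 (m : ℕ) (hm : 1 ≤ m) :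
    (∀ S : Set (ZMod m × Fin 8), IsClawDeletionSet (gadgetHm m) 3 S → 2 * m ≤ S.ncard) ∧
    (IsClawDeletionSet (gadgetHm m) 3 {p : ZMod m × Fin 8 | p.2 = 0 ∨ p.2 = 6} ∧
      ({p : ZMod m × Fin 8 | p.2 = 0 ∨ p.2 = 6}).ncard = 2 * m) ∧
    (∀ S : Set (ZMod m × Fin 8), IsClawDeletionSet (gadgetHm m) 3 S → S.ncard = 2 * m →
      (∃ j : ZMod m, (j, (0 : Fin 8)) ∈ S) →
      S = {p : ZMod m × Fin 8 | p.2 = 0 ∨ p.2 = 6} ∧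
      (∀ j : ZMod m, (j, (0 : Fin 8)) ∈ S) ∧
      (∀ j : ZMod m, (j, (1 : Fin 8)) ∉ S) ∧
      (∀ (j : ZMod m) (w : ZMod m × Fin 8), (gadgetHm m).Adj (j, (1 : Fin 8)) w →
        w ∉ S)) := by
  have : NeZero m := ⟨by omega⟩
  have hne : ∀ a ∈ ({0, 2, 3, 5} : Finset (Fin 8)), ∀ b ∈ ({1, 4, 6, 7} : Finset (Fin 8)),
      a ≠ b := by decide
  refine ⟨?_, ⟨gadgetHm_isClawDeletionSet m, ?_⟩, ?_⟩
  · intro S hS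
    obtain ⟨f, g, hf, hg⟩ := gadgetHm_exists_choice hS
    rw [← ncard_range_graph_pair fun j => hne _ (hf j).2 _ (hg j).2]
    refine Set.ncard_le_ncard (Set.union_subset ?_ ?_) (Set.toFinite _)
    · exact Set.range_subset_iff.2 fun j => (hf j).1
    · exact Set.range_subset_iff.2 fun j => (hg j).1
  · rw [← ncard_range_graph_pair (m := m) (f := fun _ => 0) (g := fun _ => 6) (by simp)]
    congr 1
    ext ⟨j, i⟩
    simp [eq_comm]
  · intro S hS hcard hj₀
    obtain ⟨f, g, hf, hg⟩ := gadgetHm_exists_choice hS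
    have hSeq : Set.range (fun j => (j, f j)) ∪ Set.range (fun j => (j, g j)) = S := by
      refine Set.eq_of_subset_of_ncard_le (Set.union_subset ?_ ?_) ?_ (Set.toFinite _)
      · exact Set.range_subset_iff.2 fun j => (hf j).1
      · exact Set.range_subset_iff.2 fun j => (hg j).1
      · rw [hcard, ncard_range_graph_pair fun j => hne _ (hf j).2 _ (hg j).2]
    have hmem : ∀ j i, (j, i) ∈ S ↔ i = f j ∨ i = g j := by
      intro j i
      rw [← hSeq]
      simp [eq_comm]
    have hstep : ∀ j, (j, (0 : Fin 8)) ∈ S → f j = 0 ∧ g j = 6 ∧ (j + 1, (0 : Fin 8)) ∈ S := by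
      intro j h0
      obtain ⟨-, h3, h4, h5, -⟩ := gadgetHm_claws hS j
      have hfj := (hf j).2
      have hgj := (hg j).2
      rw [hmem] at h0
      have hf0 : f j = 0 := by
        rcases h0 with h | h
        · exact h.symm
        · rw [← h] at hgj
          exact absurd hgj (by decide)
      simp only [hmem j, hf0] at h3 h4 h5
      have hg6 : g j = 6 := by
        generalize g j = b at h3 h5 hgj
        revert b
        decide
      rw [hg6] at h4
      exact ⟨hf0, hg6, by simpa using h4⟩
    obtain ⟨j₀, hj₀⟩ := hj₀
    have hshift : ∀ n : ℕ, (j₀ + n, (0 : Fin 8)) ∈ S := by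
      intro n
      induction n with
      | zero => simpa using hj₀
      | succ n ih => simpa [add_assoc] using (hstep _ ih).2.2
    have hall : ∀ j, (j, (0 : Fin 8)) ∈ S := by
      intro j
      simpa using hshift (j - j₀).val
    have hSfull : S = {p : ZMod m × Fin 8 | p.2 = 0 ∨ p.2 = 6} := by
      ext ⟨j, i⟩
      obtain ⟨hf0, hg6, -⟩ := hstep j (hall j)
      rw [hmem, hf0, hg6]
      rfl
    refine ⟨hSfull, hall, ?_, ?_⟩
    · intro j
      simp [hSfull]
    · rintro j ⟨k, i⟩ hadj
      rw [hSfull]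
      rintro (h | h) <;> obtain rfl : i = _ := h <;> simp [gadgetHm] at hadj
end

section
/- Let Γ be the 33-vertex graph consisting of three pairwise disjoint copies A^1, A^2, A^3 of the 11-vertex graph A (where A has vertices c, p1, p2, p3, x, y, z, q1, q2, q3, d and edges c p1, c p3, p1 p2, p2 p3, p1 x, p3 x, x y, y z, z q1, z q3, q1 q2, q2 q3, q1 d, q3 d), together with the three additional edges d^1 y^2, d^2 y^3 and d^3 y^1. Then every claw deletion set of Γ has at least 8 vertices, and Γ has a claw deletion set of size exactly 8. -/
/-- Three disjoint copies `A^1, A^2, A^3` of the 11-vertex graph `A` (vertex `(k, i)` is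
the vertex of label `i` in copy `k`, with labels `0 = c`, `1 = p1`, `2 = p2`, `3 = p3`,
`4 = x`, `5 = y`, `6 = z`, `7 = q1`, `8 = q2`, `9 = q3`, `10 = d` and edges
`c p1, c p3, p1 p2, p2 p3, p1 x, p3 x, x y, y z, z q1, z q3, q1 q2, q2 q3, q1 d, q3 d`),
together with the three edges `d^k y^{k+1}` (index modulo 3). -/
def gadget3A : SimpleGraph (ZMod 3 × Fin 11) :=
  SimpleGraph.fromRel (fun a b =>
    (a.1 = b.1 ∧
      (a.2, b.2) ∈ ([(0, 1), (0, 3), (1, 2), (2, 3), (1, 4), (3, 4), (4, 5), (5, 6),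
        (6, 7), (6, 9), (7, 8), (8, 9), (7, 10), (9, 10)] : List (Fin 11 × Fin 11))) ∨
    (b.1 = a.1 + 1 ∧ a.2 = 10 ∧ b.2 = 5))

instance gadget3A_decidableAdj : DecidableRel gadget3A.Adj := by
  unfold gadget3A
  infer_instance

/-- A `3`-claw deletion set meets every claw. -/
theorem IsClawDeletionSet.inter_claw {V : Type*} [DecidableEq V] {G : SimpleGraph V} {S : Set V}
    (hS : IsClawDeletionSet G 3 S) {v a b c : V} (hab : a ≠ b) (hac : a ≠ c) (hbc : b ≠ c)
    (ha : G.Adj v a) (hb : G.Adj v b) (hc : G.Adj v c)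
    (nab : ¬ G.Adj a b) (nac : ¬ G.Adj a c) (nbc : ¬ G.Adj b c) :
    v ∈ S ∨ a ∈ S ∨ b ∈ S ∨ c ∈ S := by
  by_contra! h
  obtain ⟨hv, ha', hb', hc'⟩ := h
  refine hS ⟨⟨v, hv⟩, {⟨a, ha'⟩, ⟨b, hb'⟩, ⟨c, hc'⟩}, ?_, ?_, ?_, ?_⟩
  · rw [Finset.card_eq_three]
    exact ⟨_, _, _, by simpa using hab, by simpa using hac, by simpa using hbc, rfl⟩
  · simp [ha.ne, hb.ne, hc.ne]
  · simp [ha, hb, hc]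
  · simp [nab, nac, nbc, G.adj_comm b a, G.adj_comm c a, G.adj_comm c b]

/-- If every vertex outside `S` has fewer than `d` neighbours outside `S`, then `S` is a
`d`-claw deletion set. -/
theorem isClawDeletionSet_of_card_lt {V : Type*} [Fintype V] [DecidableEq V] (G : SimpleGraph V)
    [DecidableRel G.Adj] {d : ℕ} (S : Finset V)
    (h : ∀ v ∉ S, (Finset.univ.filter fun u => G.Adj v u ∧ u ∉ S).card < d) :
    IsClawDeletionSet G d (S : Set V) := by
  rintro ⟨⟨v, hv⟩, s, hs, -, hadj, -⟩
  refine (h v (by simpa using hv)).not_ge ?_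
  rw [← hs, ← Finset.card_map (Function.Embedding.subtype _)]
  refine Finset.card_le_card fun u hu => ?_
  obtain ⟨⟨w, hw⟩, hws, rfl⟩ := Finset.mem_map.1 hu
  have := hadj _ hws
  simp_all

/-- Lower bounds for the part of a claw deletion set in copy `k`, where `a` is `1` on the set:
it has two vertices other than `y^k`, and at least three vertices if `y^{k+1}` is not deleted. -/
theorem gadget3A_copy_bounds {S : Set (ZMod 3 × Fin 11)} (hS : IsClawDeletionSet gadget3A 3 S)
    {a : ZMod 3 × Fin 11 → ℕ} (ha : ∀ v ∈ S, a v = 1) (k : ZMod 3) :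
    2 + a (k, 5) ≤ ∑ i, a (k, i) ∧ 3 ≤ (∑ i, a (k, i)) + a (k + 1, 5) := by
  have claw : ∀ v p q r : ZMod 3 × Fin 11,
      (p ≠ q ∧ p ≠ r ∧ q ≠ r ∧ gadget3A.Adj v p ∧ gadget3A.Adj v q ∧ gadget3A.Adj v r ∧
        ¬ gadget3A.Adj p q ∧ ¬ gadget3A.Adj p r ∧ ¬ gadget3A.Adj q r) →
      1 ≤ a v + a p + a q + a r := by
    rintro v p q r ⟨h₁, h₂, h₃, h₄, h₅, h₆, h₇, h₈, h₉⟩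
    rcases hS.inter_claw h₁ h₂ h₃ h₄ h₅ h₆ h₇ h₈ h₉ with h | h | h | h <;>
      have := ha _ h <;> omega
  have hp₁ := claw (k, 1) (k, 0) (k, 2) (k, 4) (by clear * - k; revert k; decide)
  have hp₃ := claw (k, 3) (k, 0) (k, 2) (k, 4) (by clear * - k; revert k; decide)
  have hx := claw (k, 4) (k, 1) (k, 3) (k, 5) (by clear * - k; revert k; decide)
  have hz := claw (k, 6) (k, 5) (k, 7) (k, 9) (by clear * - k; revert k; decide)
  have hq₁ := claw (k, 7) (k, 6) (k, 8) (k, 10) (by clear * - k; revert k; decide)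
  have hq₃ := claw (k, 9) (k, 6) (k, 8) (k, 10) (by clear * - k; revert k; decide)
  have hd := claw (k, 10) (k, 7) (k, 9) (k + 1, 5) (by clear * - k; revert k; decide)
  simp only [Fin.sum_univ_succ, Fin.sum_univ_zero, Fin.reduceSucc, Fin.isValue]
  constructor <;> omega

theorem stmt11 :
    (∀ S : Set (ZMod 3 × Fin 11), IsClawDeletionSet gadget3A 3 S → 8 ≤ S.ncard) ∧
    (∃ S : Set (ZMod 3 × Fin 11), IsClawDeletionSet gadget3A 3 S ∧ S.ncard = 8) := by
  classical
  constructor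
  · intro S hS
    have hcard : S.ncard = ∑ k : ZMod 3, ∑ i : Fin 11, if (k, i) ∈ S then 1 else 0 := by
      rw [← Fintype.sum_prod_type' (f := fun k i => if (k, i) ∈ S then 1 else 0),
        Set.ncard_eq_toFinset_card', Finset.sum_boole]
      simp [Set.toFinset]
    have bounds := gadget3A_copy_bounds hS (a := fun v => if v ∈ S then 1 else 0)
      fun v hv => if_pos hv
    have sum_zmod (f : ZMod 3 → ℕ) : ∑ k, f k = f 0 + f 1 + f 2 := Fin.sum_univ_three f
    rw [hcard, sum_zmod]
    have h₀ := bounds 0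
    have h₁ := bounds 1
    have h₂ := bounds 2
    rw [show (0 : ZMod 3) + 1 = 1 by decide] at h₀
    rw [show (1 : ZMod 3) + 1 = 2 by decide] at h₁
    rw [show (2 : ZMod 3) + 1 = 0 by decide] at h₂
    omega
  · refine ⟨(({(0, 4), (0, 6), (1, 0), (1, 5), (1, 10), (2, 0), (2, 5), (2, 10)} :
      Finset (ZMod 3 × Fin 11)) : Set (ZMod 3 × Fin 11)), ?_, ?_⟩
    · refine isClawDeletionSet_of_card_lt _ _ ?_
      decide
    · rw [Set.ncard_coe_finset]
      decide
end

section
/- Let Γ be the 33-vertex graph consisting of three pairwise disjoint copies A^1, A^2, A^3 of the 11-vertex graph A (where A has vertices c, p1, p2, p3, x, y, z, q1, q2, q3, d and edges c p1, c p3, p1 p2, p2 p3, p1 x, p3 x, x y, y z, z q1, z q3, q1 q2, q2 q3, q1 d, q3 d), together with the three additional edges d^1 y^2, d^2 y^3 and d^3 y^1. Then: (i) for every nonempty proper subset T of {c^1, c^2, c^3} there exists a claw deletion set of Γ of size 8 containing T; (ii) no claw deletion set of Γ of size 8 contains all three vertices c^1, c^2, c^3; and (iii) no claw deletion set of Γ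 of size 8 contains a neighbor of any c^k (that is, it contains none of the vertices p1^k, p3^k for k ∈ {1,2,3}). -/
open Finset

instance gadget3A.decidableAdj : DecidableRel gadget3A.Adj := fun a b => by
  unfold gadget3A
  rw [SimpleGraph.fromRel_adj]
  infer_instance

/-- A claw deletion set meets every induced claw with center `v` and leaves `a`, `b`, `c`. -/
theorem IsClawDeletionSet.mem_of_claw_s12 {V : Type*} {G : SimpleGraph V} {S : Set V}
    (hS : IsClawDeletionSet G 3 S) {v a b c : V}
    (hva : G.Adj v a) (hvb : G.Adj v b) (hvc : G.Adj v c)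
    (hab : a ≠ b ∧ ¬ G.Adj a b) (hac : a ≠ c ∧ ¬ G.Adj a c) (hbc : b ≠ c ∧ ¬ G.Adj b c) :
    v ∈ S ∨ a ∈ S ∨ b ∈ S ∨ c ∈ S := by
  classical
  by_contra! h
  obtain ⟨hv, ha, hb, hc⟩ := h
  refine hS ⟨⟨v, hv⟩, {⟨a, ha⟩, ⟨b, hb⟩, ⟨c, hc⟩}, ?_, ?_, ?_, ?_⟩
  · exact card_eq_three.2 ⟨_, _, _, by simpa using hab.1, by simpa using hac.1,
      by simpa using hbc.1, rfl⟩
  · simp [hva.ne, hvb.ne, hvc.ne]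
  · simp [hva, hvb, hvc]
  · simp [hab.2, hac.2, hbc.2, G.adj_comm b a, G.adj_comm c a, G.adj_comm c b]

/-- A set is a claw deletion set if every remaining vertex has at most two remaining neighbors. -/
theorem isClawDeletionSet_of_card_le_two {V : Type*} [Fintype V] [DecidableEq V]
    {G : SimpleGraph V} [DecidableRel G.Adj] {S : Finset V}
    (h : ∀ v ∉ S, #{u | G.Adj v u ∧ u ∉ S} ≤ 2) : IsClawDeletionSet G 3 (S : Set V) := by
  rintro ⟨v, s, hs, -, hadj, -⟩
  have hsub : s.map (Function.Embedding.subtype _) ⊆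
      ({u | G.Adj v u ∧ u ∉ S} : Finset V) := by
    intro u hu
    obtain ⟨w, hw, rfl⟩ := Finset.mem_map.1 hu
    simpa using ⟨hadj w hw, w.2⟩
  have hcard := card_le_card hsub
  rw [card_map, hs] at hcard
  have := h v v.2
  omega

/-- An optimal claw deletion set of `gadget3A` containing every `c` except that of copy `k`. -/
def gadget3ADeletionSet (k : ZMod 3) : Finset (ZMod 3 × Fin 11) :=
  {(k, 4), (k, 6), (k + 1, 0), (k + 1, 5), (k + 1, 10), (k + 2, 0), (k + 2, 5), (k + 2, 10)}

theorem isClawDeletionSet_gadget3ADeletionSet (k : ZMod 3) :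
    IsClawDeletionSet gadget3A 3 (gadget3ADeletionSet k : Set (ZMod 3 × Fin 11)) := by
  apply isClawDeletionSet_of_card_le_two
  revert k
  decide +kernel

theorem card_gadget3ADeletionSet (k : ZMod 3) : #(gadget3ADeletionSet k) = 8 := by
  revert k
  decide

theorem mk_zero_mem_gadget3ADeletionSet {k j : ZMod 3} (h : j ≠ k) :
    (j, 0) ∈ gadget3ADeletionSet k := by
  revert k j
  decide

/-- The number of vertices of `S` in copy `k`. -/
noncomputable def copyCount (S : Set (ZMod 3 × Fin 11)) (k : ZMod 3) : ℕ :=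
  ∑ i, S.indicator 1 (k, i)

theorem ncard_eq_sum_copyCount (S : Set (ZMod 3 × Fin 11)) (k : ZMod 3) :
    S.ncard = copyCount S k + copyCount S (k + 1) + copyCount S (k + 2) := by
  classical
  have hsum : S.ncard = ∑ k, copyCount S k := by
    have : S.ncard = ∑ v, S.indicator (1 : ZMod 3 × Fin 11 → ℕ) v := by
      rw [Set.ncard_eq_toFinset_card', ← Set.filter_mem_univ_eq_toFinset, card_filter]
      simp only [Set.indicator_apply, Pi.one_apply]
    rw [this, Fintype.sum_prod_type]
    rfl
  have huniv : (univ : Finset (ZMod 3)) = {k, k + 1, k + 2} := by decide +revert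
  rw [hsum, huniv, sum_insert (by decide +revert), sum_insert (by decide +revert),
    sum_singleton, add_assoc]

/-- Lower bounds for the number of vertices of a claw deletion set in one copy. -/
theorem copyCount_bounds {S : Set (ZMod 3 × Fin 11)} (hS : IsClawDeletionSet gadget3A 3 S)
    (k : ZMod 3) :
    2 ≤ copyCount S k ∧
    ((k, 0) ∈ S → 3 ≤ copyCount S k) ∧
    ((k, 5) ∈ S → 3 ≤ copyCount S k) ∧
    ((k, 1) ∈ S ∨ (k, 3) ∈ S → 3 ≤ copyCount S k) ∧
    ((k + 1, 5) ∉ S → 3 ≤ copyCount S k) ∧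
    ((k, 1) ∈ S ∨ (k, 3) ∈ S → (k, 5) ∈ S → 4 ≤ copyCount S k) ∧
    ((k, 1) ∈ S ∨ (k, 3) ∈ S → (k + 1, 5) ∉ S → 4 ≤ copyCount S k) := by
  let f (v : ZMod 3 × Fin 11) : ℕ := S.indicator 1 v
  have mem {v} (hv : v ∈ S) : f v = 1 := by simp [f, hv]
  have not_mem {v} (hv : v ∉ S) : f v = 0 := by simp [f, hv]
  have claw : ∀ v a b c : ZMod 3 × Fin 11,
      (gadget3A.Adj v a ∧ gadget3A.Adj v b ∧ gadget3A.Adj v c) ∧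
        (a ≠ b ∧ ¬ gadget3A.Adj a b) ∧ (a ≠ c ∧ ¬ gadget3A.Adj a c) ∧
        (b ≠ c ∧ ¬ gadget3A.Adj b c) → 1 ≤ f v + f a + f b + f c := by
    rintro v a b c ⟨⟨hva, hvb, hvc⟩, hab, hac, hbc⟩
    rcases hS.mem_of_claw_s12 hva hvb hvc hab hac hbc with h | h | h | h <;>
      have := mem h <;> omega
  have claw_p1 := claw (k, 1) (k, 0) (k, 2) (k, 4) (by clear * - k; decide +kernel +revert)
  have claw_p3 := claw (k, 3) (k, 0) (k, 2) (k, 4) (by clear * - k; decide +kernel +revert)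
  have claw_x := claw (k, 4) (k, 1) (k, 3) (k, 5) (by clear * - k; decide +kernel +revert)
  have claw_z := claw (k, 6) (k, 5) (k, 7) (k, 9) (by clear * - k; decide +kernel +revert)
  have claw_q1 := claw (k, 7) (k, 6) (k, 8) (k, 10) (by clear * - k; decide +kernel +revert)
  have claw_q3 := claw (k, 9) (k, 6) (k, 8) (k, 10) (by clear * - k; decide +kernel +revert)
  have claw_d := claw (k, 10) (k, 7) (k, 9) (k + 1, 5) (by clear * - k; decide +kernel +revert)
  have hcount : copyCount S k = f (k, 0) + f (k, 1) + f (k, 2) + f (k, 3) + f (k, 4) + f (k, 5) +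
      f (k, 6) + f (k, 7) + f (k, 8) + f (k, 9) + f (k, 10) := by
    simp only [copyCount, Fin.sum_univ_succ, univ_eq_empty, sum_empty, add_zero, ← add_assoc]
    rfl
  rw [hcount]
  clear_value f
  refine ⟨?_, fun hc => ?_, fun hy => ?_, fun hp => ?_, fun hy' => ?_, fun hp hy => ?_,
    fun hp hy' => ?_⟩
  · omega
  · have := mem hc
    omega
  · have := mem hy
    omega
  · rcases hp with hp | hp <;> have := mem hp <;> omega
  · have := not_mem hy'
    omega
  · have := mem hy
    rcases hp with hp | hp <;> have := mem hp <;> omega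
  · have := not_mem hy'
    rcases hp with hp | hp <;> have := mem hp <;> omega

theorem eq_of_gadget3A_adj_zero {k : ZMod 3} {w : ZMod 3 × Fin 11}
    (h : gadget3A.Adj (k, 0) w) : w = (k, 1) ∨ w = (k, 3) := by
  revert k w
  decide +kernel

/-- In a claw deletion set of size 8, one copy contains exactly two vertices, and the cyclically
next copy contains its vertex `y`. -/
theorem exists_copyCount_eq_two {S : Set (ZMod 3 × Fin 11)}
    (hS : IsClawDeletionSet gadget3A 3 S) (hcard : S.ncard = 8) :
    ∃ k, copyCount S k = 2 ∧ copyCount S (k + 1) = 3 ∧ copyCount S (k + 2) = 3 ∧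
      (k + 1, 5) ∈ S ∧ (k, 5) ∉ S := by
  have hsum := ncard_eq_sum_copyCount S
  obtain ⟨k, hk⟩ : ∃ k, copyCount S k = 2 := by
    by_contra! h
    have three_le (j : ZMod 3) : 3 ≤ copyCount S j := by
      have := (copyCount_bounds hS j).1
      have := h j
      omega
    have := three_le 0
    have := three_le (0 + 1)
    have := three_le (0 + 2)
    have := hsum 0
    omega
  have hsum := hsum k
  obtain ⟨-, -, hy, -, hy_next, -⟩ := copyCount_bounds hS k
  obtain ⟨-, -, hy₁, -⟩ := copyCount_bounds hS (k + 1)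
  obtain ⟨-, -, -, -, hy_next₂, -⟩ := copyCount_bounds hS (k + 2)
  have hk_cycle : k + 2 + 1 = k := by clear * - k; decide +revert
  rw [hk_cycle] at hy_next₂
  have hyk : (k, 5) ∉ S := fun h => by
    have := hy h
    omega
  have hyk₁ : (k + 1, 5) ∈ S := by
    by_contra h
    have := hy_next h
    omega
  have := hy₁ hyk₁
  have := hy_next₂ hyk
  exact ⟨k, hk, by omega, by omega, hyk₁, hyk⟩

theorem stmt12 :
    (∀ T : Set (ZMod 3 × Fin 11), T ⊆ {p | p.2 = 0} → T.Nonempty →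
      T ≠ {p : ZMod 3 × Fin 11 | p.2 = 0} →
      ∃ S : Set (ZMod 3 × Fin 11),
        IsClawDeletionSet gadget3A 3 S ∧ S.ncard = 8 ∧ T ⊆ S) ∧
    (∀ S : Set (ZMod 3 × Fin 11), IsClawDeletionSet gadget3A 3 S → S.ncard = 8 →
      ¬ ∀ k : ZMod 3, (k, (0 : Fin 11)) ∈ S) ∧
    (∀ S : Set (ZMod 3 × Fin 11), IsClawDeletionSet gadget3A 3 S → S.ncard = 8 →
      ∀ (k : ZMod 3) (w : ZMod 3 × Fin 11), gadget3A.Adj (k, (0 : Fin 11)) w →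
        w ∉ S) := by
  refine ⟨fun T hT _ hne => ?_, fun S hS hcard hc => ?_, fun S hS hcard j w hw hwS => ?_⟩
  · obtain ⟨⟨k, i⟩, hi, hk⟩ : ∃ p ∈ {p : ZMod 3 × Fin 11 | p.2 = 0}, p ∉ T :=
      Set.exists_of_ssubset (hT.ssubset_of_ne hne)
    obtain rfl : i = 0 := hi
    refine ⟨gadget3ADeletionSet k, isClawDeletionSet_gadget3ADeletionSet k, ?_, ?_⟩
    · rw [Set.ncard_coe_finset, card_gadget3ADeletionSet]
    · rintro ⟨j, i⟩ hj
      obtain rfl : i = 0 := hT hj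
      refine mk_zero_mem_gadget3ADeletionSet ?_
      rintro rfl
      exact hk hj
  · obtain ⟨k, hk, -⟩ := exists_copyCount_eq_two hS hcard
    have := (copyCount_bounds hS k).2.1 (hc k)
    omega
  · have hp : (j, 1) ∈ S ∨ (j, 3) ∈ S := by
      rcases eq_of_gadget3A_adj_zero hw with rfl | rfl
      · exact Or.inl hwS
      · exact Or.inr hwS
    obtain ⟨k, hk, hk₁, hk₂, hy₁, hy⟩ := exists_copyCount_eq_two hS hcard
    obtain ⟨-, -, -, three_le, -, four_le, four_le'⟩ := copyCount_bounds hS j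
    have hj : j = k ∨ j = k + 1 ∨ j = k + 2 ∧ k = j + 1 := by
      clear * - j k
      decide +revert
    rcases hj with rfl | rfl | ⟨rfl, hkj⟩
    · have := three_le hp
      omega
    · have := four_le hp hy₁
      omega
    · have := four_le' hp (hkj ▸ hy)
      omega
end

section
/- Let d ≥ 2 be an integer and let G be the complete bipartite graph with parts X and Y, where |X| ≥ d−1 and |Y| ≥ d−1. Then X and Y are d-claw deletion sets of G, and every d-claw deletion set S of G of minimum size satisfies: S = X, or S = Y, or S = (X ∖ X') ∪ (Y ∖ Y') for some subsets X' ⊆ X and Y' ⊆ Y with |X'| = |Y'| = d−1. -/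
/-- If `S` is a `d`-claw deletion set and the vertices of `B` are pairwise nonadjacent and adjacent
to a vertex `a ∉ S`, then fewer than `d` vertices of `B` survive the deletion. -/
lemma IsClawDeletionSet.ncard_diff_lt {V : Type*} [Finite V] {G : SimpleGraph V} {d : ℕ}
    {S B : Set V} (hS : IsClawDeletionSet G d S) {a : V} (ha : a ∉ S)
    (hadj : ∀ b ∈ B, G.Adj a b) (hind : ∀ b ∈ B, ∀ c ∈ B, ¬ G.Adj b c) :
    (B \ S).ncard < d := by
  classical
  by_contra! hle
  obtain ⟨t, htB, htd⟩ := Set.exists_subset_card_eq hle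
  have ht : t.Finite := t.toFinite
  have hmem : ∀ u ∈ ht.toFinset, u ∈ Sᶜ := fun u hu => (htB (ht.mem_toFinset.1 hu)).2
  have hB : ∀ u ∈ ht.toFinset.subtype (· ∈ Sᶜ), (u : V) ∈ B := fun u hu =>
    (htB (ht.mem_toFinset.1 (Finset.mem_subtype.1 hu))).1
  refine hS ⟨⟨a, ha⟩, ht.toFinset.subtype (· ∈ Sᶜ), ?_, ?_, ?_, ?_⟩
  · rw [Finset.card_subtype, Finset.filter_true_of_mem hmem, ← Set.ncard_eq_toFinset_card t ht, htd]
  · exact fun h => G.loopless.irrefl a (hadj a (hB _ h))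
  · exact fun u hu => hadj u (hB u hu)
  · exact fun u hu w hw _ => hind u (hB u hu) w (hB w hw)

/-- In a complete bipartite graph, `S` is a `d`-claw deletion set exactly when each part keeps fewer
than `d` vertices unless the other part is deleted entirely. -/
lemma isClawDeletionSet_iff_of_completeBipartite {V : Type*} [Finite V] {G : SimpleGraph V}
    {d : ℕ} (hd : 0 < d) {X Y : Set V} (hdisj : Disjoint X Y)
    (hadj : ∀ u v, G.Adj u v ↔ (u ∈ X ∧ v ∈ Y) ∨ (u ∈ Y ∧ v ∈ X)) (S : Set V) :
    IsClawDeletionSet G d S ↔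
      ((X \ S).Nonempty → (Y \ S).ncard < d) ∧ ((Y \ S).Nonempty → (X \ S).ncard < d) := by
  have hXY : ∀ u ∈ X, u ∉ Y := fun u hX hY => Set.disjoint_left.1 hdisj hX hY
  constructor
  · intro hS
    refine ⟨fun ⟨a, haX, haS⟩ => hS.ncard_diff_lt haS ?_ ?_,
      fun ⟨a, haY, haS⟩ => hS.ncard_diff_lt haS ?_ ?_⟩ <;> grind
  · rintro ⟨hY, hX⟩ ⟨v, s, rfl, -, hvs, -⟩
    have hcard : ∀ B : Set V, (∀ u ∈ s, (u : V) ∈ B) → s.card ≤ (B \ S).ncard := by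
      intro B hB
      rw [← Set.ncard_coe_finset s, ← Set.ncard_image_of_injective _ Subtype.val_injective]
      refine Set.ncard_le_ncard ?_ (Set.toFinite _)
      rintro _ ⟨u, hu, rfl⟩
      exact ⟨hB u hu, u.2⟩
    have hvs' : ∀ u ∈ s, ((v : V) ∈ X ∧ (u : V) ∈ Y) ∨ ((v : V) ∈ Y ∧ (u : V) ∈ X) :=
      fun u hu => (hadj _ _).1 (hvs u hu)
    obtain ⟨u, hu⟩ : s.Nonempty := Finset.card_pos.1 hd
    by_cases hvX : (v : V) ∈ X
    · exact absurd (hcard Y (by grind)) (hY ⟨v, hvX, v.2⟩).not_ge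
    · have hvY : (v : V) ∈ Y := by grind
      exact absurd (hcard X (by grind)) (hX ⟨v, hvY, v.2⟩).not_ge

theorem stmt17 {V : Type*} [Fintype V] (d : ℕ) (hd : 2 ≤ d) (G : SimpleGraph V)
    (X Y : Set V) (hdisj : Disjoint X Y) (hunion : X ∪ Y = Set.univ)
    (hadj : ∀ u v, G.Adj u v ↔ (u ∈ X ∧ v ∈ Y) ∨ (u ∈ Y ∧ v ∈ X))
    (hX : d - 1 ≤ X.ncard) (hY : d - 1 ≤ Y.ncard) :
    IsClawDeletionSet G d X ∧ IsClawDeletionSet G d Y ∧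
    ∀ S : Set V, IsClawDeletionSet G d S →
      (∀ T : Set V, IsClawDeletionSet G d T → S.ncard ≤ T.ncard) →
      S = X ∨ S = Y ∨
        ∃ X' ⊆ X, ∃ Y' ⊆ Y, X'.ncard = d - 1 ∧ Y'.ncard = d - 1 ∧
          S = (X \ X') ∪ (Y \ Y') := by
  have hiff := isClawDeletionSet_iff_of_completeBipartite (by omega : 0 < d) hdisj hadj
  have hdelX : IsClawDeletionSet G d X := by
    rw [hiff, Set.sdiff_self, Set.ncard_empty]
    exact ⟨fun h => absurd h Set.not_nonempty_empty, fun _ => by omega⟩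
  have hdelY : IsClawDeletionSet G d Y := by
    rw [hiff, Set.sdiff_self, Set.ncard_empty]
    exact ⟨fun _ => by omega, fun h => absurd h Set.not_nonempty_empty⟩
  refine ⟨hdelX, hdelY, fun S hS hmin => ?_⟩
  rcases (X \ S).eq_empty_or_nonempty with hXS | hXS
  · exact .inl (Set.eq_of_subset_of_ncard_le (Set.sdiff_eq_empty.1 hXS) (hmin X hdelX)).symm
  rcases (Y \ S).eq_empty_or_nonempty with hYS | hYS
  · exact .inr (.inl
      (Set.eq_of_subset_of_ncard_le (Set.sdiff_eq_empty.1 hYS) (hmin Y hdelY)).symm)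
  obtain ⟨hSY, hSX⟩ := (hiff S).1 hS
  obtain ⟨X', hSX', hX'X, hX'⟩ := Set.exists_subsuperset_card_eq (Set.sdiff_subset (s := X) (t := S))
    (Nat.le_sub_one_of_lt (hSX hYS)) hX
  obtain ⟨Y', hSY', hY'Y, hY'⟩ := Set.exists_subsuperset_card_eq (Set.sdiff_subset (s := Y) (t := S))
    (Nat.le_sub_one_of_lt (hSY hXS)) hY
  refine .inr (.inr ⟨X', hX'X, Y', hY'Y, hX', hY', ?_⟩)
  have hXT : X \ (X \ X' ∪ Y \ Y') ⊆ X' := fun u hu => by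
    by_contra h
    exact hu.2 (.inl ⟨hu.1, h⟩)
  have hYT : Y \ (X \ X' ∪ Y \ Y') ⊆ Y' := fun u hu => by
    by_contra h
    exact hu.2 (.inr ⟨hu.1, h⟩)
  have hT : IsClawDeletionSet G d (X \ X' ∪ Y \ Y') := by
    have hXle := Set.ncard_le_ncard hXT
    have hYle := Set.ncard_le_ncard hYT
    exact (hiff _).2 ⟨fun _ => by omega, fun _ => by omega⟩
  have hTS : X \ X' ∪ Y \ Y' ⊆ S := by
    rintro u (⟨hu, hu'⟩ | ⟨hu, hu'⟩) <;> by_contra h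
    · exact hu' (hSX' ⟨hu, h⟩)
    · exact hu' (hSY' ⟨hu, h⟩)
  exact (Set.eq_of_subset_of_ncard_le hTS (hmin _ hT)).symm
end

section
/- Let d ≥ 2 and let G be a finite simple d-block graph. Then there exists a d-claw deletion set of G of minimum size that contains no pseudo-endvertex of G. -/
/-- `v` is a cut vertex of `G`: removing `v` increases the number of connected
components. -/
def IsCutVertex {α : Type*} (G : SimpleGraph α) (v : α) : Prop :=
  Nat.card G.ConnectedComponent <
    Nat.card (G.induce {u | u ≠ v}).ConnectedComponent

/-- `B` is (the vertex set of) a block of `G`: a maximal set inducing a connected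
subgraph having no cut vertex of itself. -/
def IsBlockSet {α : Type*} (G : SimpleGraph α) (B : Set α) : Prop :=
  (G.induce B).Connected ∧ (∀ v : B, ¬ IsCutVertex (G.induce B) v) ∧
    ∀ C : Set α, B ⊆ C → (G.induce C).Connected →
      (∀ v : C, ¬ IsCutVertex (G.induce C) v) → C ⊆ B

/-- `B` is an endblock of `G`: a block containing at most one cut vertex of `G`. -/
def IsEndBlock {α : Type*} (G : SimpleGraph α) (B : Set α) : Prop :=
  IsBlockSet G B ∧ {v ∈ B | IsCutVertex G v}.Subsingleton

/-- `u` is a pseudo-endvertex of `G` (for the parameter `d`): a cut vertex belonging to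
at most `d - 2` endblocks and to exactly one block that is not an endblock. -/
def IsPseudoEndvertex {α : Type*} (d : ℕ) (G : SimpleGraph α) (u : α) : Prop :=
  IsCutVertex G u ∧
    ({B : Set α | IsEndBlock G B ∧ u ∈ B}).ncard ≤ d - 2 ∧
    (∃! B : Set α, IsBlockSet G B ∧ ¬ IsEndBlock G B ∧ u ∈ B)

/-- `G` is a `d`-block graph: every block is `K_{1,d}`-free, the neighborhood within a
block of every cut vertex lying in it is a clique, and the cut vertices lying in a
block form a clique. -/
def IsDBlockGraph {α : Type*} (d : ℕ) (G : SimpleGraph α) : Prop :=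
  ∀ B : Set α, IsBlockSet G B →
    ¬ HasNClaw (G.induce B) d ∧
    (∀ v ∈ B, IsCutVertex G v → G.IsClique (G.neighborSet v ∩ B)) ∧
    G.IsClique {v ∈ B | IsCutVertex G v}

namespace SimpleGraph

variable {α : Type*} {G : SimpleGraph α}

/-- Two vertices are linked in `D` if some walk between them stays inside `D`. -/
def LinkedIn (G : SimpleGraph α) (D : Set α) (a b : α) : Prop :=
  ∃ p : G.Walk a b, ∀ x ∈ p.support, x ∈ D

namespace LinkedIn

variable {D E : Set α} {a b c : α}

lemma refl (h : a ∈ D) : G.LinkedIn D a a := ⟨.nil, by simpa using h⟩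

lemma symm (h : G.LinkedIn D a b) : G.LinkedIn D b a := by
  obtain ⟨p, hp⟩ := h
  exact ⟨p.reverse, by simpa using hp⟩

lemma trans (h : G.LinkedIn D a b) (h' : G.LinkedIn D b c) : G.LinkedIn D a c := by
  obtain ⟨p, hp⟩ := h
  obtain ⟨q, hq⟩ := h'
  refine ⟨p.append q, fun x hx => ?_⟩
  rw [Walk.mem_support_append_iff] at hx
  exact hx.elim (hp x) (hq x)

lemma mono (hDE : D ⊆ E) (h : G.LinkedIn D a b) : G.LinkedIn E a b := by
  obtain ⟨p, hp⟩ := h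
  exact ⟨p, fun x hx => hDE (hp x hx)⟩

lemma of_adj (h : G.Adj a b) (ha : a ∈ D) (hb : b ∈ D) : G.LinkedIn D a b :=
  ⟨h.toWalk, by simp [ha, hb]⟩

end LinkedIn

lemma linkedIn_iff_reachable_induce {D : Set α} (a b : D) :
    G.LinkedIn D a b ↔ (G.induce D).Reachable a b := by
  constructor
  · rintro ⟨p, hp⟩
    exact ⟨p.induce D hp⟩
  · rintro ⟨p⟩
    refine ⟨p.map (Embedding.induce D).toHom, fun x hx => ?_⟩
    obtain ⟨y, -, rfl⟩ := List.mem_map.1 ((Walk.support_map _ p) ▸ hx)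
    exact y.2

lemma linkedIn_diff_iff_reachable_induce {C : Set α} (v : C) (a b : {u : C | u ≠ v}) :
    G.LinkedIn (C \ {v.1}) a.1 b.1 ↔
      ((G.induce C).induce {u | u ≠ v}).Reachable a b := by
  rw [← linkedIn_iff_reachable_induce]
  constructor
  · rintro ⟨p, hp⟩
    refine ⟨p.induce C fun x hx => (hp x hx).1, fun x hx => ?_⟩
    have hx' : x.1 ∈ p.support := by
      have := List.mem_map_of_mem (f := (Embedding.induce (G := G) C).toHom) hx
      rwa [← Walk.support_map, Walk.map_induce] at this
    exact fun h => (hp _ hx').2 (congrArg Subtype.val h)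
  · rintro ⟨p, hp⟩
    refine ⟨p.map (Embedding.induce C).toHom, fun x hx => ?_⟩
    obtain ⟨y, hy, rfl⟩ := List.mem_map.1 ((Walk.support_map _ p) ▸ hx)
    exact ⟨y.2, fun h => hp y hy (Subtype.ext h)⟩

/-- On a connected finite graph, the non-cut vertices are those whose removal keeps the
graph connected. -/
lemma Connected.not_isCutVertex_iff [Finite α] (hG : G.Connected) (v : α) :
    ¬ IsCutVertex G v ↔ (G.induce {u | u ≠ v}).Preconnected := by
  have := hG.preconnected.subsingleton_connectedComponent
  have : Nonempty G.ConnectedComponent := hG.nonempty.map G.connectedComponentMk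
  have h1 : Nat.card G.ConnectedComponent = 1 := Nat.card_of_subsingleton (Classical.arbitrary _)
  rw [IsCutVertex, h1, not_lt, Finite.card_le_one_iff_subsingleton]
  constructor
  · exact fun h a b => ConnectedComponent.exact (Subsingleton.elim _ _)
  · exact fun h => h.subsingleton_connectedComponent

/-- Neighbors of a non-cut vertex are linked in its complement. -/
lemma linkedIn_compl_of_not_isCutVertex [Finite α] {v a b : α} (hv : ¬ IsCutVertex G v)
    (ha : G.Adj v a) (hb : G.Adj v b) : G.LinkedIn {u | u ≠ v} a b := by
  by_contra hab
  refine hv ?_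
  let f : (G.induce {u | u ≠ v}).ConnectedComponent → G.ConnectedComponent :=
    ConnectedComponent.map (Embedding.induce {u | u ≠ v}).toHom
  have hsurj : Function.Surjective f := by
    intro c
    induction c using ConnectedComponent.ind with
    | h w =>
      by_cases hw : w = v
      · subst hw
        exact ⟨connectedComponentMk _ ⟨a, ha.ne'⟩, ConnectedComponent.sound ha.symm.reachable⟩
      · exact ⟨connectedComponentMk _ ⟨w, hw⟩, rfl⟩
  have hinj : ¬ Function.Injective f := by
    intro hf
    have hfab : f (connectedComponentMk _ ⟨a, ha.ne'⟩) = f (connectedComponentMk _ ⟨b, hb.ne'⟩) :=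
      ConnectedComponent.sound (ha.symm.reachable.trans hb.reachable)
    exact hab ((linkedIn_iff_reachable_induce (D := {u | u ≠ v}) ⟨a, ha.ne'⟩ ⟨b, hb.ne'⟩).2
      (ConnectedComponent.exact (hf hfab)))
  refine lt_of_le_of_ne (Nat.card_le_card_of_surjective f hsurj) fun h => hinj ?_
  exact ((Nat.bijective_iff_surjective_and_card f).2 ⟨hsurj, h.symm⟩).1

/-- A nonempty vertex set inducing a connected subgraph without cut vertices. -/
def IsNonseparable (G : SimpleGraph α) (C : Set α) : Prop :=
  C.Nonempty ∧ ∀ a ∈ C, ∀ b ∈ C, G.LinkedIn C a b ∧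
    ∀ x, a ≠ x → b ≠ x → G.LinkedIn (C \ {x}) a b

lemma isNonseparable_iff [Finite α] {C : Set α} :
    G.IsNonseparable C ↔
      (G.induce C).Connected ∧ ∀ v : C, ¬ IsCutVertex (G.induce C) v := by
  constructor
  · rintro ⟨hne, h⟩
    have hconn : (G.induce C).Connected :=
      { preconnected := fun a b => (linkedIn_iff_reachable_induce a b).1 (h a a.2 b b.2).1
        nonempty := hne.to_subtype }
    refine ⟨hconn, fun v => (hconn.not_isCutVertex_iff v).2 fun a b => ?_⟩
    exact (linkedIn_diff_iff_reachable_induce v a b).1 ((h a.1 a.1.2 b.1 b.1.2).2 v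
      (fun e => a.2 (Subtype.ext e)) (fun e => b.2 (Subtype.ext e)))
  · rintro ⟨hconn, h⟩
    refine ⟨Set.nonempty_coe_sort.1 hconn.nonempty, fun a ha b hb => ?_⟩
    have hab : G.LinkedIn C a b :=
      (linkedIn_iff_reachable_induce (⟨a, ha⟩ : C) ⟨b, hb⟩).2 (hconn.preconnected _ _)
    refine ⟨hab, fun x hax hbx => ?_⟩
    by_cases hx : x ∈ C
    · exact (linkedIn_diff_iff_reachable_induce ⟨x, hx⟩
        ⟨⟨a, ha⟩, fun e => hax (congrArg Subtype.val e)⟩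
        ⟨⟨b, hb⟩, fun e => hbx (congrArg Subtype.val e)⟩).2
        ((hconn.not_isCutVertex_iff _).1 (h ⟨x, hx⟩) _ _)
    · rwa [Set.sdiff_singleton_eq_self hx]

lemma isBlockSet_iff_maximal [Finite α] {B : Set α} :
    IsBlockSet G B ↔ Maximal G.IsNonseparable B := by
  simp only [Maximal, IsBlockSet, isNonseparable_iff, and_imp, and_assoc]
  exact ⟨fun h => ⟨h.1, h.2.1, fun C h1 h2 h3 => h.2.2 C h3 h1 h2⟩,
    fun h => ⟨h.1, h.2.1, fun C h1 h2 h3 => h.2.2 h2 h3 h1⟩⟩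

lemma IsNonseparable.exists_isBlockSet [Finite α] {C : Set α} (hC : G.IsNonseparable C) :
    ∃ B, C ⊆ B ∧ IsBlockSet G B := by
  obtain ⟨B, hCB, hB⟩ := (Set.toFinite {C | G.IsNonseparable C}).exists_le_maximal hC
  exact ⟨B, hCB, isBlockSet_iff_maximal.2 hB⟩

lemma IsClique.isNonseparable {C : Set α} (hC : G.IsClique C) (hne : C.Nonempty) :
    G.IsNonseparable C := by
  have key : ∀ D ⊆ C, ∀ a ∈ D, ∀ b ∈ D, G.LinkedIn D a b := by
    intro D hD a ha b hb
    by_cases hab : a = b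
    · subst hab
      exact .refl ha
    · exact .of_adj (hC (hD ha) (hD hb) hab) ha hb
  exact ⟨hne, fun a ha b hb => ⟨key C subset_rfl a ha b hb,
    fun x hax hbx => key _ Set.sdiff_subset a ⟨ha, hax⟩ b ⟨hb, hbx⟩⟩⟩

lemma IsNonseparable.union {C D : Set α} (hC : G.IsNonseparable C) (hD : G.IsNonseparable D)
    {p q : α} (hpq : p ≠ q) (hpC : p ∈ C) (hpD : p ∈ D) (hqC : q ∈ C) (hqD : q ∈ D) :
    G.IsNonseparable (C ∪ D) := by
  have link : ∀ r ∈ C, r ∈ D → ∀ a ∈ C ∪ D, G.LinkedIn (C ∪ D) a r ∧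
      ∀ x, r ≠ x → a ≠ x → G.LinkedIn ((C ∪ D) \ {x}) a r := by
    rintro r hrC hrD a (ha | ha)
    · exact ⟨(hC.2 a ha r hrC).1.mono Set.subset_union_left, fun x hrx hax =>
        ((hC.2 a ha r hrC).2 x hax hrx).mono (Set.sdiff_subset_sdiff_left Set.subset_union_left)⟩
    · exact ⟨(hD.2 a ha r hrD).1.mono Set.subset_union_right, fun x hrx hax =>
        ((hD.2 a ha r hrD).2 x hax hrx).mono (Set.sdiff_subset_sdiff_left Set.subset_union_right)⟩
  refine ⟨⟨p, Or.inl hpC⟩, fun a ha b hb => ⟨(link p hpC hpD a ha).1.trans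
    (link p hpC hpD b hb).1.symm, fun x hax hbx => ?_⟩⟩
  by_cases hpx : p = x
  · have hqx : q ≠ x := fun h => hpq (hpx.trans h.symm)
    exact ((link q hqC hqD a ha).2 x hqx hax).trans ((link q hqC hqD b hb).2 x hqx hbx).symm
  · exact ((link p hpC hpD a ha).2 x hpx hax).trans ((link p hpC hpD b hb).2 x hpx hbx).symm

/-- After removing a vertex of a path, every other vertex is still linked to an end. -/
lemma Walk.IsPath.linkedIn_or {a b : α} {p : G.Walk a b} (hp : p.IsPath) {x y : α}
    (hy : y ∈ p.support) (hyx : y ≠ x) :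
    (a ≠ x ∧ G.LinkedIn ({z | z ∈ p.support} \ {x}) y a) ∨
      (b ≠ x ∧ G.LinkedIn ({z | z ∈ p.support} \ {x}) y b) := by
  classical
  induction p with
  | nil =>
    obtain rfl : y = _ := by simpa using hy
    exact Or.inl ⟨hyx, .refl ⟨by simp, hyx⟩⟩
  | @cons a c b h q ih =>
    rw [Walk.cons_isPath_iff] at hp
    have hsub : {z | z ∈ q.support} \ {x} ⊆ {z | z ∈ (Walk.cons h q).support} \ {x} :=
      Set.sdiff_subset_sdiff_left fun z hz => by
        simpa using Or.inr hz
    rw [Walk.support_cons, List.mem_cons] at hy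
    rcases hy with rfl | hy
    · exact Or.inl ⟨hyx, .refl ⟨by simp, hyx⟩⟩
    · by_cases hax : a = x
      · subst hax
        refine Or.inr ⟨fun e => hp.2 (e ▸ q.end_mem_support), LinkedIn.mono hsub
          ⟨q.dropUntil y hy, fun z hz => ?_⟩⟩
        have hzq : z ∈ q.support := q.support_dropUntil_subset_support hy hz
        exact ⟨hzq, fun e => hp.2 (e ▸ hzq)⟩
      · rcases ih hp.1 hy with ⟨hcx, hl⟩ | ⟨hbx, hl⟩
        · refine Or.inl ⟨hax, (hl.mono hsub).trans (.of_adj h.symm ⟨by simp, hcx⟩ ⟨by simp, hax⟩)⟩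
        · exact Or.inr ⟨hbx, hl.mono hsub⟩

/-- A path together with a vertex off it adjacent to both of its ends is nonseparable. -/
lemma Walk.IsPath.isNonseparable_insert {a b v : α} {p : G.Walk a b} (hp : p.IsPath)
    (hv : v ∉ p.support) (ha : G.Adj v a) (hb : G.Adj v b) :
    G.IsNonseparable (insert v {z | z ∈ p.support}) := by
  classical
  set C : Set α := {z | z ∈ p.support}
  have hvC : v ∉ C := hv
  have hsub : C ⊆ insert v C := Set.subset_insert _ _
  have haC : a ∈ C := p.start_mem_support
  have hbC : b ∈ C := p.end_mem_support
  have link : ∀ y ∈ insert v C, ∀ x, v ≠ x → y ≠ x → G.LinkedIn (insert v C \ {x}) y v := by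
    rintro y (rfl | hy) x hvx hyx
    · exact .refl ⟨by simp, hyx⟩
    · rcases hp.linkedIn_or hy hyx with ⟨hax, hl⟩ | ⟨hbx, hl⟩
      · exact (hl.mono (Set.sdiff_subset_sdiff_left hsub)).trans
          (.of_adj ha.symm ⟨hsub haC, hax⟩ ⟨by simp, hvx⟩)
      · exact (hl.mono (Set.sdiff_subset_sdiff_left hsub)).trans
          (.of_adj hb.symm ⟨hsub hbC, hbx⟩ ⟨by simp, hvx⟩)
  have toStart : ∀ y ∈ C, G.LinkedIn C y a := fun y hy =>
    LinkedIn.symm ⟨p.takeUntil y hy, fun z hz => p.support_takeUntil_subset_support hy hz⟩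
  have toStart' : ∀ y ∈ insert v C, G.LinkedIn (insert v C) y a := by
    rintro y (rfl | hy)
    · exact .of_adj ha (by simp) (hsub haC)
    · exact (toStart y hy).mono hsub
  refine ⟨⟨v, by simp⟩, fun y hy z hz => ⟨(toStart' y hy).trans (toStart' z hz).symm, ?_⟩⟩
  intro x hyx hzx
  by_cases hvx : v = x
  · subst hvx
    rw [Set.insert_sdiff_self_of_notMem hvC]
    exact (toStart y (hy.resolve_left hyx)).trans (toStart z (hz.resolve_left hzx)).symm
  · exact (link y hy x hvx hyx).trans (link z hz x hvx hzx).symm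

end SimpleGraph

section Blocks

variable {α : Type*} {G : SimpleGraph α}

/-- A nonseparable set sharing two vertices with a block is contained in it. -/
lemma IsBlockSet.subset_of_isNonseparable [Finite α] {B C : Set α} (hB : IsBlockSet G B)
    (hC : G.IsNonseparable C) {p q : α} (hpq : p ≠ q) (hpB : p ∈ B) (hqB : q ∈ B)
    (hpC : p ∈ C) (hqC : q ∈ C) : C ⊆ B := by
  have hB' := SimpleGraph.isBlockSet_iff_maximal.1 hB
  exact Set.subset_union_right.trans
    (hB'.2 (hB'.1.union hC hpq hpB hpC hqB hqC) Set.subset_union_left)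

lemma SimpleGraph.Adj.exists_isBlockSet [Finite α] {a b : α} (h : G.Adj a b) :
    ∃ B, IsBlockSet G B ∧ a ∈ B ∧ b ∈ B := by
  have hc : G.IsClique {a, b} := SimpleGraph.isClique_pair.2 fun _ => h
  obtain ⟨B, hsub, hB⟩ := (hc.isNonseparable ⟨a, by simp⟩).exists_isBlockSet
  exact ⟨B, hB, hsub (by simp), hsub (by simp)⟩

/-- A common neighbor of two vertices of a block lies in the block. -/
lemma IsBlockSet.mem_of_adj_of_adj [Finite α] {B : Set α} (hB : IsBlockSet G B) {a b c : α}
    (ha : a ∈ B) (hb : b ∈ B) (hab : G.Adj a b) (hac : G.Adj a c) (hbc : G.Adj b c) : c ∈ B := by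
  have hc : G.IsClique {a, b, c} := by
    simp [SimpleGraph.isClique_insert, hab, hac, hbc]
  exact hB.subset_of_isNonseparable (hc.isNonseparable ⟨a, by simp⟩) hab.ne ha hb
    (by simp) (by simp) (by simp : c ∈ ({a, b, c} : Set α))

/-- A block containing a non-cut vertex and one of its neighbors contains all its neighbors. -/
lemma IsBlockSet.mem_of_adj_of_not_isCutVertex [Finite α] {B : Set α} (hB : IsBlockSet G B)
    {v a b : α} (hv : ¬ IsCutVertex G v) (hvB : v ∈ B) (haB : a ∈ B) (ha : G.Adj v a)
    (hb : G.Adj v b) : b ∈ B := by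
  classical
  obtain ⟨p, hp⟩ := SimpleGraph.linkedIn_compl_of_not_isCutVertex hv ha hb
  have hvp : v ∉ p.bypass.support := fun h => hp v (p.support_bypass_subset_support h) rfl
  exact hB.subset_of_isNonseparable (p.bypass_isPath.isNonseparable_insert hvp ha hb) ha.ne hvB haB
    (by simp) (by simp) (by simp : b ∈ insert v {z | z ∈ p.bypass.support})

end Blocks

section Claws

variable {α : Type*} {G : SimpleGraph α} {d : ℕ}

/-- `v` and `s` are the center and the leaves of an induced `d`-claw of `G`. -/
def IsNClaw (G : SimpleGraph α) (d : ℕ) (v : α) (s : Finset α) : Prop :=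
  s.card = d ∧ (∀ u ∈ s, G.Adj v u) ∧ ∀ u ∈ s, ∀ w ∈ s, u ≠ w → ¬ G.Adj u w

lemma hasNClaw_induce_iff {A : Set α} :
    HasNClaw (G.induce A) d ↔ ∃ v ∈ A, ∃ s : Finset α, (∀ u ∈ s, u ∈ A) ∧ IsNClaw G d v s := by
  classical
  constructor
  · rintro ⟨v, s, hcard, -, hadj, hind⟩
    refine ⟨v, v.2, s.map (Function.Embedding.subtype _), ?_, ?_, ?_, ?_⟩
    · simp +contextual
    · simpa using hcard
    · intro u hu
      obtain ⟨u', hu', rfl⟩ := Finset.mem_map.1 hu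
      exact hadj u' hu'
    · intro u hu w hw huw
      obtain ⟨u', hu', rfl⟩ := Finset.mem_map.1 hu
      obtain ⟨w', hw', rfl⟩ := Finset.mem_map.1 hw
      exact hind u' hu' w' hw' fun e => huw (congrArg _ e)
  · rintro ⟨v, hv, s, hsA, hcard, hadj, hind⟩
    refine ⟨⟨v, hv⟩, s.subtype (· ∈ A), ?_, ?_, ?_, ?_⟩
    · rw [Finset.card_subtype, Finset.filter_true_of_mem hsA, hcard]
    · exact fun h => (hadj v (Finset.mem_subtype.1 h)).ne rfl
    · exact fun u hu => hadj u (Finset.mem_subtype.1 hu)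
    · exact fun u hu w hw huw => hind u (Finset.mem_subtype.1 hu) w (Finset.mem_subtype.1 hw)
        fun e => huw (Subtype.ext e)

/-- The center of an induced `d`-claw of a `d`-block graph is not a pseudo-endvertex. -/
lemma IsDBlockGraph.not_isPseudoEndvertex_of_isNClaw [Finite α] (hG : IsDBlockGraph d G)
    (hd : 2 ≤ d) {u : α} {s : Finset α} (hs : IsNClaw G d u s) : ¬ IsPseudoEndvertex d G u := by
  rintro ⟨hcut, hcard, B₀, hB₀, huniq⟩
  obtain ⟨hsd, hadj, hind⟩ := hs
  choose! f hf using fun w (hw : w ∈ s) => (hadj w hw).exists_isBlockSet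
  have hinj : Set.InjOn f s := by
    intro w hw x hx hwx
    by_contra hne
    exact hind w hw x hx hne ((hG _ (hf w hw).1).2.1 u (hf w hw).2.1 hcut
      ⟨hadj w hw, (hf w hw).2.2⟩ ⟨hadj x hx, hwx ▸ (hf x hx).2.2⟩ hne)
  have hmaps : f '' s ⊆ insert B₀ {B : Set α | IsEndBlock G B ∧ u ∈ B} := by
    rintro _ ⟨w, hw, rfl⟩
    by_cases he : IsEndBlock G (f w)
    · exact Or.inr ⟨he, (hf w hw).2.1⟩
    · exact Or.inl (huniq _ ⟨(hf w hw).1, he, (hf w hw).2.1⟩)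
  have h1 := Set.ncard_le_ncard hmaps (Set.toFinite _)
  rw [hinj.ncard_image, Set.ncard_coe_finset, hsd] at h1
  have h2 := Set.ncard_insert_le B₀ {B : Set α | IsEndBlock G B ∧ u ∈ B}
  omega

/-- The center of an induced `d`-claw of a `d`-block graph is a cut vertex. -/
lemma IsDBlockGraph.isCutVertex_of_isNClaw [Finite α] (hG : IsDBlockGraph d G)
    {v u : α} {s : Finset α} (hs : IsNClaw G d v s) (hu : u ∈ s) : IsCutVertex G v := by
  by_contra hv
  obtain ⟨B, hB, hvB, huB⟩ := (hs.2.1 u hu).exists_isBlockSet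
  exact (hG B hB).1 (hasNClaw_induce_iff.2 ⟨v, hvB, s, fun w hw =>
    hB.mem_of_adj_of_not_isCutVertex hv hvB huB (hs.2.1 u hu) (hs.2.1 w hw), hs⟩)

/-- If two claws of a `d`-block graph share a pseudo-endvertex `u` as a leaf, then `u` may be
replaced in one claw by the center of the other. -/
lemma IsDBlockGraph.isNClaw_exchange [Finite α] [DecidableEq α] (hG : IsDBlockGraph d G)
    {u v w : α} {s t : Finset α} (hu : IsPseudoEndvertex d G u) (hs : IsNClaw G d v s)
    (ht : IsNClaw G d w t) (hus : u ∈ s) (hut : u ∈ t) (hvw : v ≠ w) (hvt : v ∉ t) :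
    IsNClaw G d w (insert v (t.erase u)) := by
  obtain ⟨hcut, -, hB⟩ := hu
  have hvu := hs.2.1 u hus
  have hwu := ht.2.1 u hut
  have hv := hG.isCutVertex_of_isNClaw hs hus
  have hw := hG.isCutVertex_of_isNClaw ht hut
  obtain ⟨B, hBv, hvB, huB⟩ := hvu.exists_isBlockSet
  obtain ⟨C, hCw, hwC, huC⟩ := hwu.exists_isBlockSet
  obtain rfl : B = C := hB.unique
    ⟨hBv, fun h => hvu.ne (h.2 ⟨hvB, hv⟩ ⟨huB, hcut⟩), huB⟩
    ⟨hCw, fun h => hwu.ne (h.2 ⟨hwC, hw⟩ ⟨huC, hcut⟩), huC⟩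
  have hadj : G.Adj w v := (hG B hBv).2.2 ⟨hwC, hw⟩ ⟨hvB, hv⟩ hvw.symm
  have hnadj : ∀ x ∈ t.erase u, ¬ G.Adj v x := by
    intro x hx hvx
    obtain ⟨hxu, hxt⟩ := Finset.mem_erase.1 hx
    have hxB : x ∈ B := hBv.mem_of_adj_of_adj hwC hvB hadj (ht.2.1 x hxt) hvx
    exact ht.2.2 x hxt u hut hxu
      ((hG B hBv).2.1 w hwC hw ⟨ht.2.1 x hxt, hxB⟩ ⟨hwu, huB⟩ hxu)
  refine ⟨?_, ?_, ?_⟩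
  · rw [Finset.card_insert_of_notMem fun h => hvt (Finset.mem_of_mem_erase h),
      Finset.card_erase_add_one hut, ht.1]
  · intro x hx
    rcases Finset.mem_insert.1 hx with rfl | hx
    · exact hadj
    · exact ht.2.1 x (Finset.mem_of_mem_erase hx)
  · intro x hx y hy hxy
    rcases Finset.mem_insert.1 hx with rfl | hx' <;>
      rcases Finset.mem_insert.1 hy with rfl | hy'
    · exact absurd rfl hxy
    · exact hnadj y hy'
    · exact fun h => hnadj x hx' h.symm
    · exact ht.2.2 x (Finset.mem_of_mem_erase hx') y (Finset.mem_of_mem_erase hy') hxy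

lemma isClawDeletionSet_iff {S : Set α} : IsClawDeletionSet G d S ↔
    ∀ v ∉ S, ∀ s : Finset α, (∀ u ∈ s, u ∉ S) → ¬ IsNClaw G d v s := by
  rw [IsClawDeletionSet, hasNClaw_induce_iff]
  push Not
  rfl

/-- A pseudo-endvertex in a deletion set can be dropped, or exchanged for a vertex that is
not a pseudo-endvertex. -/
lemma IsDBlockGraph.exists_isClawDeletionSet_exchange [Finite α] (hG : IsDBlockGraph d G)
    (hd : 2 ≤ d) {S : Set α} (hS : IsClawDeletionSet G d S) {u : α}
    (hu : IsPseudoEndvertex d G u) :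
    IsClawDeletionSet G d (S \ {u}) ∨
      ∃ v, ¬ IsPseudoEndvertex d G v ∧ IsClawDeletionSet G d (insert v (S \ {u})) := by
  classical
  rw [isClawDeletionSet_iff] at hS
  have leaf : ∀ v ∉ S \ {u}, ∀ s : Finset α, (∀ x ∈ s, x ∉ S \ {u}) → IsNClaw G d v s →
      v ∉ S ∧ u ∈ s := by
    intro v hv s hsS hs
    have hvu : v ≠ u := by
      rintro rfl
      exact hG.not_isPseudoEndvertex_of_isNClaw hd hs hu
    have hvS : v ∉ S := fun h => hv ⟨h, hvu⟩
    refine ⟨hvS, ?_⟩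
    by_contra hus
    refine hS v hvS s (fun x hx hxS => hsS x hx ⟨hxS, ?_⟩) hs
    rintro rfl
    exact hus hx
  by_cases hdel : IsClawDeletionSet G d (S \ {u})
  · exact Or.inl hdel
  refine Or.inr ?_
  rw [isClawDeletionSet_iff] at hdel
  push Not at hdel
  obtain ⟨v, hv, s, hsS, hs⟩ := hdel
  obtain ⟨hvS, hus⟩ := leaf v hv s hsS hs
  refine ⟨v, fun h => hG.not_isPseudoEndvertex_of_isNClaw hd hs h,
    isClawDeletionSet_iff.2 fun w hw t htS ht => ?_⟩
  have htS' : ∀ x ∈ t, x ∉ S \ {u} := fun x hx h => htS x hx (Or.inr h)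
  obtain ⟨hwS, hut⟩ := leaf w (fun h => hw (Or.inr h)) t htS' ht
  refine hS w hwS _ (fun x hx => ?_) (hG.isNClaw_exchange hu hs ht hus hut
    (fun e => hw (Or.inl e.symm)) fun h => htS v h (Or.inl rfl))
  rcases Finset.mem_insert.1 hx with rfl | hx
  · exact hvS
  · obtain ⟨hxu, hxt⟩ := Finset.mem_erase.1 hx
    exact fun h => htS' x hxt ⟨h, hxu⟩

end Claws

theorem stmt18 {α : Type*} [Fintype α] (d : ℕ) (hd : 2 ≤ d) (G : SimpleGraph α)
    (hG : IsDBlockGraph d G) :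
    ∃ S : Set α, IsClawDeletionSet G d S ∧
      (∀ T : Set α, IsClawDeletionSet G d T → S.ncard ≤ T.ncard) ∧
      ∀ u : α, IsPseudoEndvertex d G u → u ∉ S := by
  have huniv : IsClawDeletionSet G d Set.univ :=
    isClawDeletionSet_iff.2 fun v hv => absurd (Set.mem_univ v) hv
  obtain ⟨S₀, hS₀, hmin₀⟩ := Set.exists_min_image {S | IsClawDeletionSet G d S} Set.ncard
    (Set.toFinite _) ⟨_, huniv⟩
  obtain ⟨S, ⟨hS, hSmin⟩, hSP⟩ := Set.exists_min_image
    {S | IsClawDeletionSet G d S ∧ ∀ T, IsClawDeletionSet G d T → S.ncard ≤ T.ncard}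
    (fun S => (S ∩ {u | IsPseudoEndvertex d G u}).ncard) (Set.toFinite _) ⟨S₀, hS₀, hmin₀⟩
  refine ⟨S, hS, hSmin, fun u hu huS => ?_⟩
  have hlt : (S \ {u}).ncard < S.ncard := Set.ncard_sdiff_singleton_lt_of_mem huS
  rcases hG.exists_isClawDeletionSet_exchange hd hS hu with hdel | ⟨v, hv, hdel⟩
  · exact absurd (hSmin _ hdel) hlt.not_ge
  · have hcard : (insert v (S \ {u})).ncard ≤ S.ncard :=
      (Set.ncard_insert_le _ _).trans hlt
    have hle := hSP _ ⟨hdel, fun T hT => hcard.trans (hSmin T hT)⟩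
    refine hle.not_gt (Set.ncard_lt_ncard ⟨?_, fun h => ?_⟩)
    · rintro x ⟨rfl | hx, hxP⟩
      · exact absurd hxP hv
      · exact ⟨hx.1, hxP⟩
    · rcases (h ⟨huS, hu⟩).1 with rfl | h
      · exact hv hu
      · exact h.2 rfl
end

section
/- Let d ≥ 2 and let G be a finite simple d-block graph. Let v be a cut vertex of G and let B be a block of G containing v. If every vertex in N(v) ∩ B is a cut vertex of G, then every vertex of B is equal or adjacent to v (that is, B = N[v] ∩ B); in particular, the vertex set of B is a clique. -/
theorem stmt19 {α : Type*} [Fintype α] (d : ℕ) (hd : 2 ≤ d) (G : SimpleGraph α)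
    (hG : IsDBlockGraph d G) (v : α) (hv : IsCutVertex G v) (B : Set α)
    (hB : IsBlockSet G B) (hvB : v ∈ B)
    (hall : ∀ w ∈ G.neighborSet v ∩ B, IsCutVertex G w) :
    (∀ w ∈ B, w = v ∨ G.Adj v w) ∧ G.IsClique B := by
  obtain ⟨-, hnbr, hcut⟩ := hG B hB
  have step : ∀ x ∈ B, ∀ y ∈ B, G.Adj x y → (x = v ∨ G.Adj v x) → y = v ∨ G.Adj v y := by
    rintro x hx y hy hxy (rfl | hvx)
    · exact Or.inr hxy
    · by_cases hyv : y = v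
      · exact Or.inl hyv
      · exact Or.inr (hnbr x hx (hall x ⟨hvx, hx⟩) ⟨hvx.symm, hvB⟩ ⟨hxy, hy⟩ (Ne.symm hyv))
  have hclosed : ∀ a b : B, (G.induce B).Walk a b →
      ((a : α) = v ∨ G.Adj v a) → (b : α) = v ∨ G.Adj v b := by
    intro a b p
    induction p with
    | nil => exact id
    | cons h _ ih => exact fun ha => ih (step _ (Subtype.prop _) _ (Subtype.prop _) h ha)
  have hdom : ∀ w ∈ B, w = v ∨ G.Adj v w := by
    intro w hw
    obtain ⟨p⟩ := hB.1.preconnected ⟨v, hvB⟩ ⟨w, hw⟩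
    exact hclosed _ _ p (Or.inl rfl)
  have hBcut : B ⊆ {w ∈ B | IsCutVertex G w} := by
    intro w hw
    rcases hdom w hw with rfl | h
    · exact ⟨hw, hv⟩
    · exact ⟨hw, hall w ⟨h, hw⟩⟩
  exact ⟨hdom, Set.Pairwise.mono hBcut hcut⟩
end
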